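/- arXiv:1111.4989 — 3 statements merged into one kernel-verified Lean document; each statement's English description precedes it below -/
import Mathlib

section
/- Let T_x be a rooted tree and L a list assignment with |L(v)| = k for all vertices v. Then for every color i ∈ L(x), the number D_χ(T_x; L, i) of equivalence classes of distinguishing proper L-colorings in which x gets color i satisfies D_χ(T_x; L, i) ≥ D_χ(T_x; k, 1). -/
open SimpleGraph

noncomputable section

def ecc {V : Type*} [Fintype V] (G : SimpleGraph V) (v : V) : ℕ :=
  Finset.univ.sup fun u => G.dist u v

def graphCenter {V : Type*} [Fintype V] (G : SimpleGraph V) : Set V :=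
  {v | ∀ u, ecc G v ≤ ecc G u}

def desc {V : Type*} (G : SimpleGraph V) (x v : V) : Set V :=
  {u | G.dist u x = G.dist u v + G.dist v x}

lemma self_mem_desc {V : Type*} (G : SimpleGraph V) (x v : V) : v ∈ desc G x v := by
  simp [desc]

def Distinguishes {V α : Type*} (G : SimpleGraph V) (r : V) (φ : V → α) : Prop :=
  ∀ σ : G ≃g G, σ r = r → (∀ w, φ (σ w) = φ w) → ∀ w, σ w = w

def DistinguishesU {V α : Type*} (G : SimpleGraph V) (φ : V → α) : Prop :=
  ∀ σ : G ≃g G, (∀ w, φ (σ w) = φ w) → ∀ w, σ w = w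

def RootedIso {V W : Type*} (G : SimpleGraph V) (H : SimpleGraph W) (r : V) (s : W) : Prop :=
  ∃ π : G ≃g H, π r = s

def ColEquiv {V W α : Type*} (G : SimpleGraph V) (H : SimpleGraph W) (r : V) (s : W)
    (φ : V → α) (ψ : W → α) : Prop :=
  ∃ π : G ≃g H, π r = s ∧ ∀ w, φ w = ψ (π w)

def IsProper {V α : Type*} (G : SimpleGraph V) (φ : V → α) : Prop :=
  ∀ a b, G.Adj a b → φ a ≠ φ b

def DCount {V : Type*} (G : SimpleGraph V) (r : V) (k : ℕ) : ℕ :=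
  Nat.card (Quot fun φ ψ : {f : V → Fin k // Distinguishes G r f} =>
    ∃ σ : G ≃g G, σ r = r ∧ ∀ w, φ.1 w = ψ.1 (σ w))

def DCountL {V : Type*} (G : SimpleGraph V) (r : V) (L : V → Finset ℕ) : ℕ :=
  Nat.card (Quot fun φ ψ : {f : V → ℕ // (∀ v, f v ∈ L v) ∧ Distinguishes G r f} =>
    ∃ σ : G ≃g G, σ r = r ∧ ∀ w, φ.1 w = ψ.1 (σ w))

def DChiCount {V : Type*} (G : SimpleGraph V) (r : V) (k : ℕ) : ℕ :=
  Nat.card (Quot fun φ ψ : {f : V → Fin k // IsProper G f ∧ Distinguishes G r f} =>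
    ∃ σ : G ≃g G, σ r = r ∧ ∀ w, φ.1 w = ψ.1 (σ w))

def DChiCountI {V : Type*} (G : SimpleGraph V) (r : V) (k : ℕ) (i : Fin k) : ℕ :=
  Nat.card (Quot fun φ ψ : {f : V → Fin k // IsProper G f ∧ Distinguishes G r f ∧ f r = i} =>
    ∃ σ : G ≃g G, σ r = r ∧ ∀ w, φ.1 w = ψ.1 (σ w))

def DChiCountLI {V : Type*} (G : SimpleGraph V) (r : V) (L : V → Finset ℕ) (i : ℕ) : ℕ :=
  Nat.card (Quot fun φ ψ : {f : V → ℕ // (∀ v, f v ∈ L v) ∧ IsProper G f ∧ Distinguishes G r f ∧ f r = i} =>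
    ∃ σ : G ≃g G, σ r = r ∧ ∀ w, φ.1 w = ψ.1 (σ w))

def DNum {V : Type*} (G : SimpleGraph V) (r : V) : ℕ :=
  sInf {k | ∃ φ : V → Fin k, Distinguishes G r φ}

def DListNum {V : Type*} (G : SimpleGraph V) (r : V) : ℕ :=
  sInf {k | ∀ L : V → Finset ℕ, (∀ v, (L v).card = k) →
    ∃ φ : V → ℕ, (∀ v, φ v ∈ L v) ∧ Distinguishes G r φ}

def DNumU {V : Type*} (G : SimpleGraph V) : ℕ :=
  sInf {k | ∃ φ : V → Fin k, DistinguishesU G φ}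

def DListNumU {V : Type*} (G : SimpleGraph V) : ℕ :=
  sInf {k | ∀ L : V → Finset ℕ, (∀ v, (L v).card = k) →
    ∃ φ : V → ℕ, (∀ v, φ v ∈ L v) ∧ DistinguishesU G φ}

def chiD {V : Type*} (G : SimpleGraph V) (r : V) : ℕ :=
  sInf {k | ∃ φ : V → Fin k, IsProper G φ ∧ Distinguishes G r φ}

def chiDL {V : Type*} (G : SimpleGraph V) (r : V) : ℕ :=
  sInf {k | ∀ L : V → Finset ℕ, (∀ v, (L v).card = k) →
    ∃ φ : V → ℕ, (∀ v, φ v ∈ L v) ∧ IsProper G φ ∧ Distinguishes G r φ}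

def chiDU {V : Type*} (G : SimpleGraph V) : ℕ :=
  sInf {k | ∃ φ : V → Fin k, IsProper G φ ∧ DistinguishesU G φ}

def chiDLU {V : Type*} (G : SimpleGraph V) : ℕ :=
  sInf {k | ∀ L : V → Finset ℕ, (∀ v, (L v).card = k) →
    ∃ φ : V → ℕ, (∀ v, φ v ∈ L v) ∧ IsProper G φ ∧ DistinguishesU G φ}

def subdiv {V : Type*} (G : SimpleGraph V) (u v : V) : SimpleGraph (V ⊕ Unit) :=
  SimpleGraph.fromRel fun a b =>
    match a, b with
    | Sum.inl a, Sum.inl b => G.Adj a b ∧ ¬(a = u ∧ b = v) ∧ ¬(a = v ∧ b = u)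
    | Sum.inl a, Sum.inr _ => a = u ∨ a = v
    | Sum.inr _, _ => False

def childOf {V : Type*} (G : SimpleGraph V) (r v u : V) : Prop :=
  G.Adj v u ∧ G.dist u r = G.dist v r + 1

section aux
open Classical

def goodF {ι : Type*} [Fintype ι] {X : ι → Type*} (E : ∀ i j, X i → X j → Prop)
    (A : ∀ i, Finset (X i)) : Finset (∀ i, X i) :=
  (Fintype.piFinset A).filter fun f => ∀ i j, i ≠ j → ¬ E i j (f i) (f j)

lemma mem_goodF {ι : Type*} [Fintype ι] {X : ι → Type*} {E : ∀ i j, X i → X j → Prop}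
    {A : ∀ i, Finset (X i)} {f : ∀ i, X i} : f ∈ goodF E A ↔
    (∀ i, f i ∈ A i) ∧ ∀ i j, i ≠ j → ¬ E i j (f i) (f j) := by
  simp [goodF]

def extF {ι : Type*} [Fintype ι] {X : Option ι → Type*} (E : ∀ i j, X i → X j → Prop)
    (A : Finset (X none)) (f : ∀ i : ι, X (some i)) : Finset (X none) :=
  A.filter fun x => ∀ i, ¬ E (some i) none (f i) x

lemma fiber_card {ι : Type*} [Fintype ι] {X : Option ι → Type*} (E : ∀ i j, X i → X j → Prop)
    (hs : ∀ i j f g, E i j f g → E j i g f)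
    (A : ∀ i, Finset (X i)) (f : ∀ i : ι, X (some i))
    (hf : f ∈ goodF (fun i j => E (some i) (some j)) (fun i => A (some i))) :
    ((goodF E A).filter fun F => (fun i => F (some i)) = f).card = (extF E (A none) f).card := by
  rw [mem_goodF] at hf
  refine Finset.card_bij (fun F _ => F none) ?_ ?_ ?_
  · intro F hF
    simp only [Finset.mem_filter, mem_goodF] at hF
    obtain ⟨⟨h1, h2⟩, rfl⟩ := hF
    simp only [extF, Finset.mem_filter]
    exact ⟨h1 none, fun i => h2 _ _ (by simp)⟩
  · intro F hF F' hF' h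
    simp only [Finset.mem_filter, mem_goodF] at hF hF'
    have := hF.2.trans hF'.2.symm
    funext o
    cases o with
    | none => exact h
    | some i => exact congrFun this i
  · intro x hx
    simp only [extF, Finset.mem_filter] at hx
    refine ⟨fun o => match o with | none => x | some i => f i, ?_, rfl⟩
    simp only [Finset.mem_filter, mem_goodF]
    refine ⟨⟨?_, ?_⟩, ?_⟩
    · rintro (_ | i)
      · exact hx.1
      · exact hf.1 i
    · rintro (_ | i) (_ | j) hij
      · exact absurd rfl hij
      · exact fun h => hx.2 j (hs _ _ _ _ h)
      · exact hx.2 i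
      · exact hf.2 i j (by simpa using hij)
    · trivial

lemma ext_le {ι : Type*} [Fintype ι] {X : Option ι → Type*} (E : ∀ i j, X i → X j → Prop)
    (ht : ∀ i j l f g h, E i l f h → E j l g h → E i j f g)
    (A : ∀ i, Finset (X i)) (m : ι → ℕ) (f : ∀ i : ι, X (some i))
    (hA : ∀ i, ∀ f ∈ A (some i), m i ≤ ((A none).filter fun g => E (some i) none f g).card)
    (hf : f ∈ goodF (fun i j => E (some i) (some j)) (fun i => A (some i))) :
    (extF E (A none) f).card ≤ (A none).card - ∑ i, m i := by
  rw [mem_goodF] at hf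
  have h1 : ∑ i, m i ≤
      (Finset.univ.biUnion fun i => (A none).filter fun g => E (some i) none (f i) g).card := by
    rw [Finset.card_biUnion]
    · exact Finset.sum_le_sum fun i _ => hA i _ (hf.1 i)
    · intro i _ j _ hij
      rw [Function.onFun, Finset.disjoint_left]
      intro x hx hx'
      simp only [Finset.mem_filter] at hx hx'
      exact hf.2 i j hij (ht _ _ _ _ _ _ hx.2 hx'.2)
  have h2 : Disjoint (extF E (A none) f)
      (Finset.univ.biUnion fun i => (A none).filter fun g => E (some i) none (f i) g) := by
    rw [Finset.disjoint_left]
    intro x hx hx'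
    simp only [extF, Finset.mem_filter, Finset.mem_biUnion] at hx hx'
    obtain ⟨i, _, h⟩ := hx'
    exact hx.2 i h.2
  have h3 : (extF E (A none) f) ∪
      (Finset.univ.biUnion fun i => (A none).filter fun g => E (some i) none (f i) g) ⊆ A none := by
    intro x hx
    simp only [extF, Finset.mem_union, Finset.mem_filter, Finset.mem_biUnion] at hx
    rcases hx with h | ⟨i, _, h⟩
    · exact h.1
    · exact h.1
  have h4 := Finset.card_le_card h3
  rw [Finset.card_union_of_disjoint h2] at h4
  omega

lemma le_ext {ι : Type*} [Fintype ι] {X : Option ι → Type*} (E : ∀ i j, X i → X j → Prop)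
    (A : ∀ i, Finset (X i)) (m : ι → ℕ) (f : ∀ i : ι, X (some i))
    (hA : ∀ i, ∀ f ∈ A (some i), ((A none).filter fun g => E (some i) none f g).card ≤ m i)
    (hf : f ∈ goodF (fun i j => E (some i) (some j)) (fun i => A (some i))) :
    (A none).card - ∑ i, m i ≤ (extF E (A none) f).card := by
  rw [mem_goodF] at hf
  have h1 : (Finset.univ.biUnion fun i => (A none).filter fun g => E (some i) none (f i) g).card
      ≤ ∑ i, m i :=
    Finset.card_biUnion_le.trans (Finset.sum_le_sum fun i _ => hA i _ (hf.1 i))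
  have h3 : A none ⊆ (extF E (A none) f) ∪
      (Finset.univ.biUnion fun i => (A none).filter fun g => E (some i) none (f i) g) := by
    intro x hx
    simp only [extF, Finset.mem_union, Finset.mem_filter, Finset.mem_biUnion]
    by_cases h : ∀ i, ¬ E (some i) none (f i) x
    · exact Or.inl ⟨hx, h⟩
    · push Not at h
      obtain ⟨i, hi⟩ := h
      exact Or.inr ⟨i, Finset.mem_univ _, hx, hi⟩
  have h4 := (Finset.card_le_card h3).trans (Finset.card_union_le _ _)
  omega

def CombP (ι : Type*) [Fintype ι] : Prop :=
  ∀ (X : ι → Type*) (E : ∀ i j, X i → X j → Prop) (A B : ∀ i, Finset (X i)) (m : ι → ι → ℕ),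
    (∀ i j f g, E i j f g → E j i g f) →
    (∀ i j l f g h, E i l f h → E j l g h → E i j f g) →
    (∀ i, (A i).card ≤ (B i).card) →
    (∀ i j, ∀ f ∈ A i, m i j ≤ ((A j).filter fun g => E i j f g).card) →
    (∀ i j, ∀ f ∈ B i, ((B j).filter fun g => E i j f g).card ≤ m i j) →
    (goodF E A).card ≤ (goodF E B).card

lemma goodF_reindex {α β : Type*} [Fintype α] [Fintype β] (e : α ≃ β) {X : β → Type*}
    (E : ∀ i j, X i → X j → Prop) (A : ∀ i, Finset (X i)) :
    (goodF E A).card = (goodF (fun i j => E (e i) (e j)) (fun i => A (e i))).card := by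
  refine Finset.card_bij (fun F _ => fun i => F (e i)) ?_ ?_ ?_
  · intro F hF
    rw [mem_goodF] at hF ⊢
    exact ⟨fun i => hF.1 _, fun i j hij => hF.2 _ _ (by simpa using hij)⟩
  · intro F _ F' _ h
    funext b
    obtain ⟨a, rfl⟩ := e.surjective b
    exact congrFun h a
  · intro F hF
    rw [mem_goodF] at hF
    have key : ∀ a, (Equiv.piCongrLeft X e F) (e a) = F a := fun a =>
      Equiv.piCongrLeft_apply_apply _ _ _ _
    refine ⟨Equiv.piCongrLeft X e F, ?_, funext key⟩
    rw [mem_goodF]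
    constructor
    · intro b
      obtain ⟨a, rfl⟩ := e.surjective b
      rw [key]; exact hF.1 a
    · intro b c hbc
      obtain ⟨a, rfl⟩ := e.surjective b
      obtain ⟨a', rfl⟩ := e.surjective c
      rw [key, key]; exact hF.2 a a' (by simpa using hbc)

universe u v

lemma comb (ι : Type u) [Fintype ι] : CombP.{u, v} ι := by
  refine Fintype.induction_empty_option (P := fun ι _ => CombP.{u, v} ι) ?_ ?_ ?_ ι
  · intro α β _ e h X E A B m hs ht hAB hA hB
    let _ := Fintype.ofEquiv β e.symm
    have := h (fun a => X (e a)) (fun i j => E (e i) (e j)) (fun i => A (e i)) (fun i => B (e i))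
      (fun i j => m (e i) (e j)) (fun _ _ => hs _ _) (fun _ _ _ => ht _ _ _) (fun _ => hAB _)
      (fun _ _ => hA _ _) (fun _ _ => hB _ _)
    rw [goodF_reindex e, goodF_reindex e]
    exact this
  · intro X E A B m hs ht hAB hA hB
    apply Finset.card_le_card
    intro f _
    rw [mem_goodF]
    exact ⟨fun i => i.elim, fun i => i.elim⟩
  · intro ι _ h X E A B m hs ht hAB hA hB
    have ih := h (fun a => X (some a)) (fun i j => E (some i) (some j)) (fun i => A (some i))
      (fun i => B (some i)) (fun i j => m (some i) (some j)) (fun _ _ => hs _ _)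
      (fun _ _ _ => ht _ _ _) (fun _ => hAB _) (fun _ _ => hA _ _) (fun _ _ => hB _ _)
    have h1 := Finset.card_le_mul_card_image_of_maps_to (s := goodF E A)
      (t := goodF (fun i j => E (some i) (some j)) (fun i => A (some i)))
      (f := fun F i => F (some i)) (fun F hF => by
        rw [mem_goodF] at hF ⊢
        exact ⟨fun i => hF.1 _, fun i j hij => hF.2 _ _ (by simpa using hij)⟩)
      ((A none).card - ∑ i, m (some i) none) (fun f hf => by
        rw [fiber_card E hs A f hf]
        exact ext_le E ht A _ f (fun i => hA _ _) hf)
    have h2 := Finset.mul_card_image_le_card_of_maps_to (s := goodF E B)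
      (t := goodF (fun i j => E (some i) (some j)) (fun i => B (some i)))
      (f := fun F i => F (some i)) (fun F hF => by
        rw [mem_goodF] at hF ⊢
        exact ⟨fun i => hF.1 _, fun i j hij => hF.2 _ _ (by simpa using hij)⟩)
      ((B none).card - ∑ i, m (some i) none) (fun f hf => by
        rw [fiber_card E hs B f hf]
        exact le_ext E B _ f (fun i => hB _ _) hf)
    refine h1.trans (le_trans ?_ h2)
    exact Nat.mul_le_mul (Nat.sub_le_sub_right (hAB none) _) ih

inductive NAdj {ι : Type*} {V : ι → Type*} (G : ∀ i, SimpleGraph (V i)) (r : ∀ i, V i) :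
    Option (Σ i, V i) → Option (Σ i, V i) → Prop
  | inn (i : ι) (a b : V i) : (G i).Adj a b → NAdj G r (some ⟨i, a⟩) (some ⟨i, b⟩)
  | up (i : ι) : NAdj G r (some ⟨i, r i⟩) none
  | down (i : ι) : NAdj G r none (some ⟨i, r i⟩)

def nodeG {ι : Type*} {V : ι → Type*} (G : ∀ i, SimpleGraph (V i)) (r : ∀ i, V i) :
    SimpleGraph (Option (Σ i, V i)) where
  Adj := NAdj G r
  symm := ⟨by
    rintro _ _ (⟨i, a, b, h⟩ | i | i)
    · exact .inn i b a h.symm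
    · exact .down i
    · exact .up i⟩
  loopless := ⟨by
    rintro (_ | ⟨i, a⟩) h
    · cases h
    · cases h with
      | inn _ _ _ h => exact (G i).irrefl h⟩

section node
variable {ι : Type*} {V : ι → Type*} {G : ∀ i, SimpleGraph (V i)} {r : ∀ i, V i}

lemma node_inn {i : ι} {a b : V i} :
    (nodeG G r).Adj (some ⟨i, a⟩) (some ⟨i, b⟩) ↔ (G i).Adj a b := by
  constructor
  · intro h
    cases h with
    | inn _ _ _ h => exact h
  · exact NAdj.inn i a b

lemma node_same {i j : ι} {a : V i} {b : V j}
    (h : (nodeG G r).Adj (some ⟨i, a⟩) (some ⟨j, b⟩)) : i = j := by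
  cases h with
  | inn _ _ _ h => rfl

lemma node_root {i : ι} {a : V i} :
    (nodeG G r).Adj none (some ⟨i, a⟩) ↔ a = r i := by
  constructor
  · intro h
    cases h with
    | down => rfl
  · rintro rfl
    exact NAdj.down i

lemma node_adj_map {ι' : Type*} {V' : ι' → Type*} {G' : ∀ i, SimpleGraph (V' i)} {r' : ∀ i, V' i}
    (p : ι → ι') (t : ∀ i, V i → V' (p i)) (hr : ∀ i, t i (r i) = r' (p i))
    (ha : ∀ i a b, (G i).Adj a b → (G' (p i)).Adj (t i a) (t i b))
    {x y : Option (Σ i, V i)} (h : (nodeG G r).Adj x y) :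
    (nodeG G' r').Adj (x.map (Sigma.map p t)) (y.map (Sigma.map p t)) := by
  rcases h with ⟨i, a, b, h⟩ | i | i
  · exact .inn _ _ _ (ha i a b h)
  · simp only [Option.map_some, Sigma.map, hr]; exact .up _
  · simp only [Option.map_some, Sigma.map, hr]; exact .down _

lemma node_adj_reflect (p : Equiv.Perm ι) (t : ∀ i, G i ≃g G (p i)) (hr : ∀ i, t i (r i) = r (p i))
    {x y : Option (Σ i, V i)}
    (h : (nodeG G r).Adj (x.map (Sigma.map p fun i => t i)) (y.map (Sigma.map p fun i => t i))) :
    (nodeG G r).Adj x y := by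
  rcases x with _ | ⟨i, a⟩ <;> rcases y with _ | ⟨j, b⟩
  · cases h
  · simp only [Option.map_some, Option.map_none, Sigma.map] at h
    rw [node_root, ← hr] at h
    rw [node_root]; exact (t j).injective h
  · have h := h.symm
    simp only [Option.map_some, Option.map_none, Sigma.map] at h
    rw [node_root, ← hr] at h
    apply SimpleGraph.Adj.symm
    rw [node_root]; exact (t i).injective h
  · simp only [Option.map_some, Sigma.map] at h
    obtain rfl := p.injective (node_same h)
    rw [node_inn] at h ⊢
    exact (t i).map_adj_iff.1 h

def extIso (p : Equiv.Perm ι) (t : ∀ i, G i ≃g G (p i)) (hr : ∀ i, t i (r i) = r (p i)) :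
    nodeG G r ≃g nodeG G r where
  toEquiv := Equiv.ofBijective (Option.map (Sigma.map p fun i => t i))
    ⟨Option.map_injective (Function.Injective.sigma_map p.injective fun i => (t i).injective), by
      rintro (_ | ⟨j, b⟩)
      · exact ⟨none, rfl⟩
      · obtain ⟨i, rfl⟩ := p.surjective j
        obtain ⟨a, rfl⟩ := (t i).surjective b
        exact ⟨some ⟨i, a⟩, rfl⟩⟩
  map_rel_iff' := by
    intro x y
    exact ⟨node_adj_reflect p t hr, node_adj_map p (fun i => t i) hr
      fun i a b h => (t i).map_adj_iff.2 h⟩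

lemma extIso_none (p : Equiv.Perm ι) (t : ∀ i, G i ≃g G (p i)) (hr : ∀ i, t i (r i) = r (p i)) :
    extIso p t hr none = none := rfl

lemma extIso_some (p : Equiv.Perm ι) (t : ∀ i, G i ≃g G (p i)) (hr : ∀ i, t i (r i) = r (p i))
    (i : ι) (a : V i) :
    extIso p t hr (some ⟨i, a⟩) = some ⟨p i, t i a⟩ := rfl

lemma some_of_fix (σ : nodeG G r ≃g nodeG G r) (h0 : σ none = none) (s : Σ i, V i) :
    ∃ s', σ (some s) = some s' := by
  cases h : σ (some s) with
  | none => exact absurd (σ.injective (h.trans h0.symm)) (by simp)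
  | some s' => exact ⟨s', rfl⟩

lemma same_comp (hc : ∀ i, (G i).Connected) (σ : nodeG G r ≃g nodeG G r) (h0 : σ none = none)
    {i j : ι} (a₀ : V i) (b₀ : V j) (h : σ (some ⟨i, a₀⟩) = some ⟨j, b₀⟩) (a : V i) :
    ∃ b : V j, σ (some ⟨i, a⟩) = some ⟨j, b⟩ := by
  obtain ⟨w⟩ := (hc i).preconnected a₀ a
  induction w generalizing b₀ with
  | nil => exact ⟨_, h⟩
  | cons hadj p ih =>
    rename_i u v w
    obtain ⟨⟨j', b'⟩, h'⟩ := some_of_fix σ h0 ⟨i, v⟩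
    have := σ.map_adj_iff.2 ((node_inn (G := G) (r := r)).2 hadj)
    rw [h, h'] at this
    obtain rfl := node_same this
    exact ih b' h'

lemma exists_iso (hc : ∀ i, (G i).Connected) (σ : nodeG G r ≃g nodeG G r) (h0 : σ none = none)
    (i : ι) : ∃ j, ∃ t : G i ≃g G j, t (r i) = r j ∧ ∀ a, σ (some ⟨i, a⟩) = some ⟨j, t a⟩ := by
  obtain ⟨⟨j, b₀⟩, h⟩ := some_of_fix σ h0 ⟨i, r i⟩
  have hr : b₀ = r j := by
    have := σ.map_adj_iff.2 ((node_root (G := G) (r := r)).2 (rfl : r i = r i))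
    rw [h0, h] at this
    exact node_root.1 this
  choose t ht using same_comp hc σ h0 (r i) b₀ h
  have h0' : σ.symm none = none := by
    have := σ.symm_apply_apply none
    rwa [h0] at this
  have h' : σ.symm (some ⟨j, b₀⟩) = some ⟨i, r i⟩ := by rw [← h]; simp
  have hb := same_comp hc σ.symm h0' b₀ (r i) h'
  have hinj : Function.Injective t := by
    intro a a' haa
    have : σ (some ⟨i, a⟩) = σ (some ⟨i, a'⟩) := by rw [ht, ht, haa]
    simpa using σ.injective this
  have hsurj : Function.Surjective t := by
    intro b
    obtain ⟨a, ha⟩ := hb b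
    refine ⟨a, ?_⟩
    have h1 := ht a
    rw [← ha] at h1
    simpa using h1.symm
  refine ⟨j, ⟨Equiv.ofBijective t ⟨hinj, hsurj⟩, ?_⟩, ?_, ht⟩
  · intro a b
    have := σ.map_adj_iff (v := some ⟨i, a⟩) (w := some ⟨i, b⟩)
    rw [ht, ht, node_inn, node_inn] at this
    exact this
  · have h1 := ht (r i)
    rw [h] at h1
    change t (r i) = r j
    rw [← hr]
    simpa using h1.symm

lemma node_dist (hc : ∀ i, (G i).Connected) (f : Option (Σ i, V i) → ℕ) :
    Distinguishes (nodeG G r) none f ↔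
      (∀ i, Distinguishes (G i) (r i) fun a => f (some ⟨i, a⟩)) ∧
      ∀ i j, i ≠ j → ¬ ColEquiv (G i) (G j) (r i) (r j) (fun a => f (some ⟨i, a⟩))
        (fun a => f (some ⟨j, a⟩)) := by
  constructor
  · intro hd
    constructor
    · have : ∀ i, ∃ t : G i ≃g G i, t (r i) = r i ∧
          (∀ a, f (some ⟨i, t a⟩) = f (some ⟨i, a⟩)) ∧
          ((∀ a, t a = a) → Distinguishes (G i) (r i) fun a => f (some ⟨i, a⟩)) := by
        intro i
        by_cases h : Distinguishes (G i) (r i) fun a => f (some ⟨i, a⟩)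
        · exact ⟨RelIso.refl _, rfl, fun _ => rfl, fun _ => h⟩
        · have h' := h
          unfold Distinguishes at h'
          push Not at h'
          obtain ⟨σ, h1, h2, w, hw⟩ := h'
          exact ⟨σ, h1, h2, fun h => absurd (h w) hw⟩
      choose t h1 h2 h3 using this
      intro i
      apply h3
      intro a
      have := hd (extIso (Equiv.refl ι) t h1) (extIso_none _ _ _) (by
        rintro (_ | ⟨i, a⟩)
        · rfl
        · exact h2 i a) (some ⟨i, a⟩)
      have h4 : some (⟨i, t i a⟩ : Σ i, V i) = some ⟨i, a⟩ := this
      simpa using h4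
    · intro i j hij he
      have : ∀ l, ColEquiv (G l) (G (Equiv.swap i j l)) (r l) (r (Equiv.swap i j l))
          (fun a => f (some ⟨l, a⟩)) (fun a => f (some ⟨Equiv.swap i j l, a⟩)) := by
        intro l
        by_cases hi : l = i
        · subst hi; rw [Equiv.swap_apply_left]; exact he
        by_cases hj : l = j
        · subst hj; rw [Equiv.swap_apply_right]
          obtain ⟨t, h1, h2⟩ := he
          refine ⟨t.symm, by rw [← h1]; simp, fun w => ?_⟩
          rw [h2]; simp
        · rw [Equiv.swap_apply_of_ne_of_ne hi hj]
          exact ⟨RelIso.refl _, rfl, fun _ => rfl⟩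
      choose t h1 h2 using this
      have := hd (extIso (Equiv.swap i j) t h1) (extIso_none _ _ _) (by
        rintro (_ | ⟨i, a⟩)
        · rfl
        · rw [extIso_some]; exact (h2 i a).symm) (some ⟨i, r i⟩)
      rw [extIso_some, Option.some_inj] at this
      have := congrArg Sigma.fst this
      simp only [Equiv.swap_apply_left] at this
      exact hij this.symm
  · rintro ⟨hd, hn⟩ σ h0 hσ (_ | ⟨i, a⟩)
    · exact h0
    · obtain ⟨j, t, h1, h2⟩ := exists_iso hc σ h0 i
      by_cases hij : i = j
      · subst hij
        rw [h2, hd i t h1 (fun w => by simp only [← h2, hσ])]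
      · exact absurd ⟨t, h1, fun w => by simp only [← h2, hσ]⟩ (hn i j hij)

lemma node_proper (f : Option (Σ i, V i) → ℕ) :
    IsProper (nodeG G r) f ↔
      (∀ i, IsProper (G i) fun a => f (some ⟨i, a⟩)) ∧ ∀ i, f (some ⟨i, r i⟩) ≠ f none := by
  constructor
  · intro h
    exact ⟨fun i a b hab => h _ _ (node_inn.2 hab), fun i => (h _ _ (node_root.2 rfl)).symm⟩
  · rintro ⟨h1, h2⟩ _ _ (⟨i, a, b, h⟩ | i | i)
    · exact h1 i a b h
    · exact h2 i
    · exact (h2 i).symm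

end node

def colR {V : Type*} [Fintype V] (G : SimpleGraph V) (r : V) (L : V → Finset ℕ) (R : ℕ → Prop) :
    Finset (V → ℕ) :=
  (Fintype.piFinset L).filter fun f => IsProper G f ∧ Distinguishes G r f ∧ R (f r)

lemma mem_colR {V : Type*} [Fintype V] {G : SimpleGraph V} {r : V} {L : V → Finset ℕ}
    {R : ℕ → Prop} {f : V → ℕ} : f ∈ colR G r L R ↔
    (∀ v, f v ∈ L v) ∧ IsProper G f ∧ Distinguishes G r f ∧ R (f r) := by
  simp [colR]

abbrev RIso {V W : Type*} (G : SimpleGraph V) (H : SimpleGraph W) (r : V) (s : W) : Type _ :=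
  {π : G ≃g H // π r = s}

lemma riso_finite {V W : Type*} [Finite V] [Finite W] (G : SimpleGraph V) (H : SimpleGraph W)
    (r : V) (s : W) : Finite (RIso G H r s) :=
  Finite.of_injective (fun π : RIso G H r s => (π.1 : V → W)) (by
    rintro ⟨π, h⟩ ⟨π', h'⟩ hh
    exact Subtype.ext (DFunLike.coe_injective hh))

lemma dist_comp {V W α : Type*} {G : SimpleGraph V} {H : SimpleGraph W} {r : V} {s : W}
    (π : G ≃g H) (h : π r = s) {f : V → α} (hf : Distinguishes G r f) :
    Distinguishes H s (fun w => f (π.symm w)) := by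
  intro σ h1 h2 w
  have := hf ((π.trans σ).trans π.symm) (by
    rw [RelIso.trans_apply, RelIso.trans_apply, h, h1, ← h]; simp) (fun v => by
    have := h2 (π v)
    simpa using this) (π.symm w)
  simp only [RelIso.trans_apply, RelIso.apply_symm_apply] at this
  exact π.symm.injective this

lemma proper_comp {V W α : Type*} {G : SimpleGraph V} {H : SimpleGraph W}
    (π : G ≃g H) {f : V → α} (hf : IsProper G f) :
    IsProper H (fun w => f (π.symm w)) :=
  fun _ _ h => hf _ _ (π.symm.map_adj_iff.2 h)

lemma colR_comp {V W : Type*} [Fintype V] [Fintype W] {G : SimpleGraph V} {H : SimpleGraph W}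
    {r : V} {s : W} (π : G ≃g H) (h : π r = s) {L : W → Finset ℕ} {R : ℕ → Prop} {f : V → ℕ}
    (hf : f ∈ colR G r (fun v => L (π v)) R) : (fun w => f (π.symm w)) ∈ colR H s L R := by
  rw [mem_colR] at hf ⊢
  obtain ⟨h1, h2, h3, h4⟩ := hf
  refine ⟨fun w => ?_, proper_comp π h2, dist_comp π h h3, ?_⟩
  · simpa using h1 (π.symm w)
  · subst h; simpa using h4

lemma colR_card_le {V W : Type*} [Fintype V] [Fintype W] {G : SimpleGraph V} {H : SimpleGraph W}
    {r : V} {s : W} (π : G ≃g H) (h : π r = s) (L : W → Finset ℕ) (R : ℕ → Prop) :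
    (colR G r (fun v => L (π v)) R).card ≤ (colR H s L R).card := by
  refine Finset.card_le_card_of_injOn (fun f w => f (π.symm w)) (fun f hf => colR_comp π h hf) ?_
  intro f _ g _ hfg
  funext v
  simpa using congrFun hfg (π v)

lemma riso_inj {V W α : Type*} {G : SimpleGraph V} {H : SimpleGraph W}
    {r : V} {s : W} {f : V → α} (hf : Distinguishes G r f) (π π' : RIso G H r s)
    (h : (fun w => f (π.1.symm w)) = fun w => f (π'.1.symm w)) : π = π' := by
  obtain ⟨π, h1⟩ := π
  obtain ⟨π', h2⟩ := π'
  apply Subtype.ext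
  apply DFunLike.ext
  intro v
  have := hf (π.trans π'.symm) (by
    rw [RelIso.trans_apply, h1, ← h2]; simp) (fun w => by
    have := congrFun h (π w)
    simpa using this.symm) v
  change π'.symm (π v) = v at this
  change π v = π' v
  have h3 := congrArg π' this
  simpa using h3

lemma fib_le {V W : Type*} [Fintype V] [Fintype W] (G : SimpleGraph V) (H : SimpleGraph W)
    (r : V) (s : W) (f : V → ℕ) (B : Finset (W → ℕ)) :
    (B.filter fun g => ColEquiv G H r s f g).card ≤ Nat.card (RIso G H r s) := by
  have := riso_finite G H r s
  have := Fintype.ofFinite (RIso G H r s)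
  rw [Nat.card_eq_fintype_card, ← Finset.card_univ]
  refine le_trans (Finset.card_le_card ?_) (Finset.card_image_le
    (f := fun (π : RIso G H r s) (w : W) => f (π.1.symm w)))
  intro g hg
  simp only [Finset.mem_filter] at hg
  obtain ⟨_, π, h1, h2⟩ := hg
  simp only [Finset.mem_image, Finset.mem_univ, true_and]
  exact ⟨⟨π, h1⟩, funext fun w => by rw [h2]; simp⟩

lemma le_fib {V W : Type*} [Fintype V] [Fintype W] (G : SimpleGraph V) (H : SimpleGraph W)
    (r : V) (s : W) (f : V → ℕ) (B : Finset (W → ℕ)) (hf : Distinguishes G r f)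
    (hB : ∀ π : RIso G H r s, (fun w => f (π.1.symm w)) ∈ B) :
    Nat.card (RIso G H r s) ≤ (B.filter fun g => ColEquiv G H r s f g).card := by
  have := riso_finite G H r s
  have := Fintype.ofFinite (RIso G H r s)
  rw [Nat.card_eq_fintype_card, ← Finset.card_univ]
  refine Finset.card_le_card_of_injOn
    (fun (π : RIso G H r s) (w : W) => f (π.1.symm w)) ?_ ?_
  · intro π _
    simp only [Finset.coe_filter, Set.mem_ofPred_eq]
    exact ⟨hB π, π.1, π.2, fun w => by simp⟩
  · intro π _ π' _ h
    exact riso_inj hf _ _ h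

def PP {V : Type*} [Fintype V] (G : SimpleGraph V) (r : V) : Prop :=
  ∀ (C : Finset ℕ) (L : V → Finset ℕ), (∀ v, C.card ≤ (L v).card) → ∀ c ∈ C, ∀ d ∈ L r,
    (colR G r (fun _ => C) (· = c)).card ≤ (colR G r L (· = d)).card

lemma PP_iso {V W : Type*} [Fintype V] [Fintype W] {G : SimpleGraph V} {H : SimpleGraph W}
    {r : V} {s : W} (π : G ≃g H) (h : π r = s) (hP : PP G r) : PP H s := by
  intro C L hL c hc d hd
  have h1 := colR_card_le π.symm (by rw [← h]; simp : π.symm s = r) (fun _ => C) (· = c)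
  have h2 := colR_card_le π h L (· = d)
  exact h1.trans ((hP C (fun v => L (π v)) (fun v => hL _) c hc d (by rw [h]; exact hd)).trans h2)

lemma sum_comp (s t : Finset ℕ) (a b : ℕ → ℕ) (h : s.card ≤ t.card)
    (hab : ∀ c ∈ s, ∀ d ∈ t, a c ≤ b d) : ∑ c ∈ s, a c ≤ ∑ d ∈ t, b d := by
  calc ∑ c ∈ s, a c ≤ s.card • s.sup a :=
        Finset.sum_le_card_nsmul _ _ _ fun c hc => Finset.le_sup hc
    _ ≤ t.card • s.sup a := Nat.mul_le_mul_right _ h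
    _ ≤ ∑ d ∈ t, b d := Finset.card_nsmul_le_sum _ _ _ fun d hd =>
        Finset.sup_le fun c hc => hab c hc d hd

lemma colR_ne_card {V : Type*} [Fintype V] (G : SimpleGraph V) (r : V) (L : V → Finset ℕ)
    (c : ℕ) : (colR G r L (· ≠ c)).card = ∑ c' ∈ (L r).erase c, (colR G r L (· = c')).card := by
  rw [Finset.card_eq_sum_card_fiberwise (f := fun f => f r) (t := (L r).erase c)]
  · refine Finset.sum_congr rfl fun c' hc' => ?_
    congr 1
    ext f
    simp only [Finset.mem_filter, mem_colR]
    have := (Finset.mem_erase.1 hc').1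
    constructor
    · rintro ⟨⟨h1, h2, h3, h4⟩, h5⟩; exact ⟨h1, h2, h3, h5⟩
    · rintro ⟨h1, h2, h3, h5⟩; exact ⟨⟨h1, h2, h3, by rw [h5]; exact this⟩, h5⟩
  · intro f hf
    have hf := mem_colR.1 (Finset.mem_coe.1 hf)
    exact Finset.mem_coe.2 (Finset.mem_erase.2 ⟨hf.2.2.2, hf.1 r⟩)

lemma PP_ne {V : Type*} [Fintype V] {G : SimpleGraph V} {r : V} (hP : PP G r) (C : Finset ℕ)
    (L : V → Finset ℕ) (hL : ∀ v, C.card ≤ (L v).card) (c d : ℕ) (hc : c ∈ C) :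
    (colR G r (fun _ => C) (· ≠ c)).card ≤ (colR G r L (· ≠ d)).card := by
  rw [colR_ne_card, colR_ne_card]
  refine sum_comp _ _ _ _ ?_ ?_
  · rw [Finset.card_erase_of_mem hc]
    exact (Nat.sub_le_sub_right (hL r) 1).trans Finset.pred_card_le_card_erase
  · intro c' hc' d' hd'
    exact hP C L hL c' (Finset.mem_of_mem_erase hc') d' (Finset.mem_of_mem_erase hd')

lemma node_card {ι : Type*} {V : ι → Type*} [Fintype ι] [∀ i, Fintype (V i)]
    {G : ∀ i, SimpleGraph (V i)} {r : ∀ i, V i} (hc : ∀ i, (G i).Connected)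
    (L : Option (Σ i, V i) → Finset ℕ) (d : ℕ) (hd : d ∈ L none) :
    (colR (nodeG G r) none L (· = d)).card =
      (goodF (X := fun i => V i → ℕ) (fun i j f g => ColEquiv (G i) (G j) (r i) (r j) f g)
        (fun i => colR (G i) (r i) (fun a => L (some ⟨i, a⟩)) (· ≠ d))).card := by
  refine Finset.card_bij (fun F _ i a => F (some ⟨i, a⟩)) ?_ ?_ ?_
  · intro F hF
    rw [mem_colR, node_dist hc, node_proper] at hF
    obtain ⟨h1, ⟨h2, h3⟩, ⟨h4, h5⟩, h6⟩ := hF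
    rw [mem_goodF]
    refine ⟨fun i => ?_, h5⟩
    rw [mem_colR]
    exact ⟨fun a => h1 _, h2 i, h4 i, by rw [← h6]; exact h3 i⟩
  · intro F hF F' hF' h
    rw [mem_colR] at hF hF'
    funext o
    rcases o with _ | ⟨i, a⟩
    · exact hF.2.2.2.trans hF'.2.2.2.symm
    · exact congrFun (congrFun h i) a
  · intro f hf
    rw [mem_goodF] at hf
    obtain ⟨h1, h2⟩ := hf
    simp only [mem_colR] at h1
    refine ⟨fun o => match o with | none => d | some ⟨i, a⟩ => f i a, ?_, rfl⟩
    rw [mem_colR, node_dist hc, node_proper]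
    refine ⟨?_, ⟨fun i => (h1 i).2.1, fun i => (h1 i).2.2.2⟩, ⟨fun i => (h1 i).2.2.1, h2⟩, rfl⟩
    rintro (_ | ⟨i, a⟩)
    · exact hd
    · exact (h1 i).1 a

lemma PP_node {ι : Type*} {V : ι → Type*} [Fintype ι] [∀ i, Fintype (V i)]
    {G : ∀ i, SimpleGraph (V i)} {r : ∀ i, V i} (hc : ∀ i, (G i).Connected)
    (hP : ∀ i, PP (G i) (r i)) : PP (nodeG G r) none := by
  intro C L hL c hcC d hd
  rw [node_card hc _ c hcC, node_card hc L d hd]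
  refine comb ι _ _ _ _ (fun i j => Nat.card (RIso (G i) (G j) (r i) (r j))) ?_ ?_ ?_ ?_ ?_
  · rintro i j f g ⟨π, h1, h2⟩
    exact ⟨π.symm, by rw [← h1]; simp, fun w => by rw [h2]; simp⟩
  · rintro i j l f g h ⟨π, h1, h2⟩ ⟨π', h1', h2'⟩
    refine ⟨π.trans π'.symm, ?_, fun w => ?_⟩
    · rw [RelIso.trans_apply, h1, ← h1']; simp
    · rw [h2, h2']; simp
  · intro i
    exact PP_ne (hP i) C _ (fun v => hL _) c d hcC
  · intro i j f hf
    refine le_fib _ _ _ _ _ _ (mem_colR.1 hf).2.2.1 ?_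
    intro π
    exact colR_comp π.1 π.2 (L := fun _ => C) hf
  · intro i j f hf
    exact fib_le _ _ _ _ _ _

lemma exists_root {V : Type*} {G : SimpleGraph V} (hG : G.IsTree) (x : V)
    (C : (G.induce ({x}ᶜ : Set V)).ConnectedComponent) :
    ∃ u : C.supp, G.Adj x u.1.1 ∧ ∀ w : C.supp, G.Adj x w.1.1 → w = u := by
  have hex : ∃ u : C.supp, G.Adj x u.1.1 := by
    by_contra hno
    push Not at hno
    obtain ⟨w, hw⟩ := C.exists_rep
    have hw : w ∈ C.supp := hw
    have key : ∀ a b : V, G.Walk a b → (∃ h : a ∈ ({x}ᶜ : Set V), (⟨a, h⟩ : ({x}ᶜ : Set V)) ∈ C.supp) →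
        (∃ h : b ∈ ({x}ᶜ : Set V), (⟨b, h⟩ : ({x}ᶜ : Set V)) ∈ C.supp) := by
      intro a b p
      induction p with
      | nil => exact id
      | cons hadj p ih =>
        rename_i u v _
        rintro ⟨h, hC⟩
        apply ih
        have hv : v ∈ ({x}ᶜ : Set V) := by
          rintro rfl
          exact hno ⟨_, hC⟩ hadj.symm
        refine ⟨hv, ?_⟩
        exact C.mem_supp_of_adj_mem_supp (v := ⟨v, hv⟩) hC hadj
    obtain ⟨p⟩ := hG.1.preconnected w.1 x
    obtain ⟨h, _⟩ := key _ _ p ⟨w.2, hw⟩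
    exact h rfl
  obtain ⟨u, hu⟩ := hex
  refine ⟨u, hu, fun w hw => ?_⟩
  by_contra hne
  have hreach : (G.induce ({x}ᶜ : Set V)).Reachable u.1 w.1 :=
    C.reachable_of_mem_supp u.2 w.2
  obtain ⟨p, hp⟩ := hreach.exists_isPath
  have hp' := Walk.IsPath.map (f := (Embedding.induce ({x}ᶜ : Set V)).toHom)
    (Embedding.induce (G := G) ({x}ᶜ : Set V)).injective hp
  have hne' : u.1.1 ≠ w.1.1 := fun h => hne (Subtype.ext (Subtype.ext h.symm))
  have hxu : x ≠ u.1.1 := fun h => u.1.2 h.symm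
  have hxw : x ≠ w.1.1 := fun h => w.1.2 h.symm
  have hq : (Walk.cons hu.symm (Walk.cons hw Walk.nil)).IsPath := by
    simp [Walk.cons_isPath_iff, hxw, hxu.symm, hne']
  have := hG.2.path_unique ⟨_, hp'⟩ ⟨_, hq⟩
  have h1 := congrArg (fun q => q.1.support) this
  have h2 : x ∈ (Walk.cons hu.symm (Walk.cons hw Walk.nil)).support := by simp
  dsimp only at h1
  have h2 : x ∈ (Walk.map (Embedding.induce (G := G) ({x}ᶜ : Set V)).toHom p).support :=
    h1.symm ▸ h2
  rw [Walk.support_map] at h2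
  obtain ⟨y, _, hy⟩ := List.mem_map.1 h2
  exact y.2 hy

lemma decomp {V : Type*} {G : SimpleGraph V} (hG : G.IsTree) (x : V)
    (r : ∀ C : (G.induce ({x}ᶜ : Set V)).ConnectedComponent, C.supp)
    (h1 : ∀ C, G.Adj x (r C).1.1) (h2 : ∀ C, ∀ w : C.supp, G.Adj x w.1.1 → w = r C) :
    ∃ e : nodeG (fun C : (G.induce ({x}ᶜ : Set V)).ConnectedComponent => (G.induce ({x}ᶜ : Set V)).induce C.supp) r ≃g G,
      e none = x := by
  let F : Option (Σ C : (G.induce ({x}ᶜ : Set V)).ConnectedComponent, C.supp) → V := fun o =>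
    match o with
    | none => x
    | some s => s.2.1.1
  have hinj : Function.Injective F := by
    rintro (_ | ⟨C, w⟩) (_ | ⟨D, z⟩) h
    · rfl
    · exact absurd h.symm z.1.2
    · exact absurd h w.1.2
    · have hwz : w.1 = z.1 := Subtype.ext h
      have hCD : C = D := by
        have e1 := w.2
        have e2 := z.2
        rw [← hwz] at e2
        exact e1.symm.trans e2
      subst hCD
      obtain rfl : w = z := Subtype.ext hwz
      rfl
  have hsurj : Function.Surjective F := by
    intro v
    by_cases h : v = x
    · exact ⟨none, h.symm⟩
    · exact ⟨some ⟨(G.induce ({x}ᶜ : Set V)).connectedComponentMk ⟨v, h⟩, ⟨⟨v, h⟩, rfl⟩⟩, rfl⟩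
  refine ⟨⟨Equiv.ofBijective F ⟨hinj, hsurj⟩, ?_⟩, rfl⟩
  intro a b
  change G.Adj (F a) (F b) ↔ _
  rcases a with _ | ⟨C, w⟩ <;> rcases b with _ | ⟨D, z⟩
  · simp
  · rw [node_root]
    exact ⟨h2 D z, fun h => h ▸ h1 D⟩
  · rw [SimpleGraph.adj_comm, SimpleGraph.adj_comm _ (some _), node_root]
    exact ⟨h2 C w, fun h => h ▸ h1 C⟩
  · constructor
    · intro h
      have hadj : (G.induce ({x}ᶜ : Set V)).Adj w.1 z.1 := h
      have hCD : C = D := by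
        have e1 := C.mem_supp_of_adj_mem_supp w.2 hadj
        exact e1.symm.trans z.2
      subst hCD
      rw [node_inn]
      exact hadj
    · intro h
      obtain rfl := node_same h
      rw [node_inn] at h
      exact h

lemma main_PP (n : ℕ) : ∀ (V : Type u) [Fintype V] (G : SimpleGraph V) (x : V), G.IsTree →
    Fintype.card V ≤ n → PP G x := by
  induction n with
  | zero =>
    intro V _ G x _ h
    have := Fintype.card_pos_iff.2 ⟨x⟩
    omega
  | succ n ih =>
    intro V _ G x hG hn
    choose r h1 h2 using exists_root hG x
    obtain ⟨e, he⟩ := decomp hG x r h1 h2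
    have hT : ∀ C : (G.induce ({x}ᶜ : Set V)).ConnectedComponent,
        ((G.induce ({x}ᶜ : Set V)).induce C.supp).IsTree :=
      fun C => (hG.2.induce _).isTree_connectedComponent C
    have : Fintype (G.induce ({x}ᶜ : Set V)).ConnectedComponent := Fintype.ofFinite _
    have : ∀ C : (G.induce ({x}ᶜ : Set V)).ConnectedComponent, Fintype C.supp :=
      fun C => Fintype.ofFinite _
    refine PP_iso e he (PP_node (fun C => (hT C).1) fun C => ih _ _ _ (hT C) ?_)
    have hlt : Fintype.card C.supp < Fintype.card V := by
      refine Fintype.card_lt_of_injective_of_notMem (fun w : C.supp => w.1.1) ?_ (b := x) ?_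
      · intro w z h
        exact Subtype.ext (Subtype.ext h)
      · rintro ⟨w, hw⟩
        exact w.1.2 hw
    omega

lemma quot_unif {V : Type*} [Fintype V] (G : SimpleGraph V) (x : V) (k : ℕ) (hk : 0 < k) :
    Nat.card (RIso G G x x) * DChiCountI G x k ⟨0, hk⟩ ≤
      (colR G x (fun _ => Finset.range k) (· = 0)).card := by
  unfold DChiCountI
  set X := {f : V → Fin k // IsProper G f ∧ Distinguishes G x f ∧ f x = ⟨0, hk⟩} with hX
  have := riso_finite G G x x
  have : Fintype (RIso G G x x) := Fintype.ofFinite _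
  have : Fintype X := Fintype.ofFinite _
  have hXc : Fintype.card X ≤ (colR G x (fun _ => Finset.range k) (· = 0)).card := by
    rw [← Finset.card_univ]
    refine Finset.card_le_card_of_injOn (fun f w => (f.1 w : ℕ)) ?_ ?_
    · rintro ⟨f, h1, h2, h3⟩ _
      refine Finset.mem_coe.2 (mem_colR.2 ⟨fun v => by simp, fun a b h => ?_, fun σ hσ hh => ?_, ?_⟩)
      · exact fun e => h1 a b h (Fin.ext e)
      · exact h2 σ hσ fun w => Fin.ext (hh w)
      · simp [h3]
    · intro f _ g _ h
      exact Subtype.ext (funext fun w => Fin.ext (congrFun h w))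
  refine le_trans ?_ hXc
  set rel : X → X → Prop := fun φ ψ => ∃ σ : G ≃g G, σ x = x ∧ ∀ w, φ.1 w = ψ.1 (σ w) with hrel
  have : Fintype (Quot rel) := Fintype.ofFinite _
  rw [Nat.card_eq_fintype_card, Nat.card_eq_fintype_card, ← Finset.card_univ (α := Quot rel),
    ← Finset.card_univ (α := X)]
  refine Finset.mul_card_image_le_card_of_maps_to (f := Quot.mk rel) (fun _ _ => Finset.mem_univ _)
    _ ?_
  intro q _
  obtain ⟨φ, rfl⟩ := Quot.exists_rep q
  rw [← Finset.card_univ]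
  refine Finset.card_le_card_of_injOn (fun π => (⟨fun w => φ.1 (π.1.symm w),
    proper_comp π.1 φ.2.1, dist_comp π.1 π.2 φ.2.2.1, by
      have : π.1.symm x = x := by
        have := π.1.symm_apply_apply x
        rwa [π.2] at this
      change φ.1 (π.1.symm x) = _
      rw [this]; exact φ.2.2.2⟩ : X)) ?_ ?_
  · intro π _
    simp only [Finset.coe_filter, Set.mem_ofPred_eq, Finset.mem_univ, true_and]
    symm
    exact Quot.sound ⟨π.1, π.2, fun w => by simp⟩
  · intro π _ π' _ h
    exact riso_inj φ.2.2.1 _ _ (congrArg Subtype.val h)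

lemma quot_list {V : Type*} [Fintype V] (G : SimpleGraph V) (x : V) (L : V → Finset ℕ) (i : ℕ) :
    (colR G x L (· = i)).card ≤ Nat.card (RIso G G x x) * DChiCountLI G x L i := by
  unfold DChiCountLI
  set X := {f : V → ℕ // (∀ v, f v ∈ L v) ∧ IsProper G f ∧ Distinguishes G x f ∧ f x = i} with hX
  have := riso_finite G G x x
  have : Fintype (RIso G G x x) := Fintype.ofFinite _
  have : Fintype X := Fintype.subtype (colR G x L (· = i)) fun f => mem_colR (R := (· = i))
  have hXc : Fintype.card X = (colR G x L (· = i)).card :=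
    Fintype.card_of_subtype _ fun f => mem_colR (R := (· = i))
  rw [← hXc]
  set rel : X → X → Prop := fun φ ψ => ∃ σ : G ≃g G, σ x = x ∧ ∀ w, φ.1 w = ψ.1 (σ w) with hrel
  have heq : Equivalence rel := by
    refine ⟨fun φ => ⟨RelIso.refl _, rfl, fun _ => rfl⟩, ?_, ?_⟩
    · rintro φ ψ ⟨σ, h1, h2⟩
      refine ⟨σ.symm, ?_, fun w => by rw [h2]; simp⟩
      have := σ.symm_apply_apply x
      rwa [h1] at this
    · rintro φ ψ χ ⟨σ, h1, h2⟩ ⟨τ, h3, h4⟩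
      exact ⟨σ.trans τ, by simp [h1, h3], fun w => by rw [h2, h4]; rfl⟩
  have : Fintype (Quot rel) := Fintype.ofFinite _
  rw [Nat.card_eq_fintype_card (α := Quot rel), ← Finset.card_univ (α := Quot rel),
    ← Finset.card_univ (α := X)]
  refine Finset.card_le_mul_card_image_of_maps_to (f := Quot.mk rel) (fun _ _ => Finset.mem_univ _)
    _ ?_
  intro q _
  obtain ⟨φ, rfl⟩ := Quot.exists_rep q
  refine le_trans ?_ (fib_le G G x x φ.1 (colR G x L (· = i)))
  refine Finset.card_le_card_of_injOn (fun ψ => ψ.1) ?_ ?_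
  · intro ψ hψ
    simp only [Finset.coe_filter, Set.mem_ofPred_eq, Finset.mem_univ, true_and] at hψ ⊢
    exact ⟨mem_colR.2 ψ.2, heq.quot_mk_eq_iff _ _ |>.1 hψ.symm⟩
  · intro ψ _ ψ' _ h
    exact Subtype.ext h

end aux

theorem stmt12 {V : Type*} [Fintype V] (G : SimpleGraph V) (hG : G.IsTree)
    (x : V) (k : ℕ) (hk : 0 < k) (L : V → Finset ℕ)
    (hL : ∀ v, (L v).card = k) :
    ∀ i ∈ L x, DChiCountI G x k ⟨0, hk⟩ ≤ DChiCountLI G x L i := by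
  intro i hi
  have h1 := quot_unif G x k hk
  have h2 := quot_list G x L i
  have h3 := main_PP _ V G x hG le_rfl (Finset.range k) L (fun v => by simp [hL v]) 0
    (by simpa using hk) i hi
  have := riso_finite G G x x
  have : Nonempty (RIso G G x x) := ⟨⟨RelIso.refl _, rfl⟩⟩
  exact Nat.le_of_mul_le_mul_left (h1.trans (h3.trans h2)) Nat.card_pos
end
end

section
/- For every rooted tree T, the distinguishing chromatic number equals the list distinguishing chromatic number: χ_D(T) = χ_{D_ℓ}(T). -/
open SimpleGraph

noncomputable section

section Comb
variable {V : Type*} [Fintype V] [DecidableEq V]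

lemma exists_match {β : Type*} (h : V → β) (C' : Finset V) : ∀ C : Finset V,
    C'.val.map h = C.val.map h →
    ∃ f : V → V, C'.val.map f = C.val ∧ ∀ x ∈ C', h (f x) = h x := by
  induction C' using Finset.induction_on with
  | empty =>
    intro C hC
    refine ⟨id, ?_, by simp⟩
    have : C.val = 0 := by
      simpa using hC.symm
    simp [this]
  | insert a C' ha ih =>
    intro C hC
    rw [Finset.insert_val_of_notMem ha, Multiset.map_cons] at hC
    have h1 : h a ∈ C.val.map h := by rw [← hC]; simp
    obtain ⟨b, hb, hba⟩ := Multiset.mem_map.1 h1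
    have hCb : C.val = b ::ₘ (C.erase b).val := by
      rw [Finset.erase_val, Multiset.cons_erase hb]
    rw [hCb, Multiset.map_cons, hba, Multiset.cons_inj_right] at hC
    obtain ⟨f, hf, hfh⟩ := ih _ hC
    refine ⟨Function.update f a b, ?_, ?_⟩
    · rw [Finset.insert_val_of_notMem ha, Multiset.map_cons, hCb, ← hf]
      simp only [Function.update_self]
      congr 1
      apply Multiset.map_congr rfl
      intro x hx
      rw [Function.update_of_ne]
      rintro rfl; exact ha hx
    · intro x hx
      by_cases hxa : x = a
      · subst hxa; simpa using hba
      · rw [Function.update_of_ne hxa]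
        exact hfh x ((Finset.mem_insert.1 hx).resolve_left hxa)

def itrans (C : Finset V) (A : V → Finset ℕ) : Finset (V → ℕ) :=
  (Fintype.piFinset (fun c => if c ∈ C then A c else {0})).filter (fun g => Set.InjOn g C)

lemma mem_itrans {C : Finset V} {A : V → Finset ℕ} {g : V → ℕ} : g ∈ itrans C A ↔
    (∀ c ∈ C, g c ∈ A c) ∧ (∀ c, c ∉ C → g c = 0) ∧ Set.InjOn g C := by
  classical
  simp only [itrans, Finset.mem_filter, Fintype.mem_piFinset]
  constructor
  · rintro ⟨h1, h2⟩
    refine ⟨fun c hc => by simpa [hc] using h1 c, fun c hc => by simpa [hc] using h1 c, h2⟩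
  · rintro ⟨h1, h2, h3⟩
    refine ⟨fun c => ?_, h3⟩
    by_cases hc : c ∈ C
    · simpa [hc] using h1 c hc
    · simpa [hc] using h2 c hc

lemma card_itrans_le {β : Type*} [DecidableEq β] (sh : V → β) (A B : V → Finset ℕ) (C : Finset V)
    (hA : ∀ a ∈ C, ∀ b ∈ C, sh a = sh b → A a = A b)
    (hB : ∀ a ∈ C, ∀ b ∈ C, ∀ s, s ∈ B a → s ∈ B b → sh a = sh b)
    (hAB : ∀ c ∈ C, (A c).card ≤ (B c).card) : (itrans C A).card ≤ (itrans C B).card := by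
  classical
  induction C using Finset.induction_on with
  | empty =>
    apply le_of_eq; congr 1
  | insert a C ha ih =>
    have ih' := ih (fun x hx y hy => hA x (by simp [hx]) y (by simp [hy]))
      (fun x hx y hy => hB x (by simp [hx]) y (by simp [hy])) (fun c hc => hAB c (by simp [hc]))
    set D := C.filter (fun c => sh c = sh a) with hD
    have hDC : D ⊆ C := Finset.filter_subset _ _
    have e1 : (itrans (insert a C) A).card ≤ ((A a).card - D.card) * (itrans C A).card := by
      apply Finset.card_le_mul_card_image_of_maps_to (f := fun g => Function.update g a 0)
      · intro g hg
        rw [mem_itrans] at hg ⊢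
        obtain ⟨h1, h2, h3⟩ := hg
        refine ⟨fun c hc => ?_, fun c hc => ?_, fun x hx y hy hxy => ?_⟩
        · rw [Function.update_of_ne (by rintro rfl; exact ha hc)]
          exact h1 c (by simp [hc])
        · by_cases hca : c = a
          · simp [hca]
          · rw [Function.update_of_ne hca]; exact h2 c (by simp [hc, hca])
        · rw [Function.update_of_ne (by rintro rfl; exact ha hx),
            Function.update_of_ne (by rintro rfl; exact ha hy)] at hxy
          exact h3 (by simp [Finset.mem_coe.1 hx]) (by simp [Finset.mem_coe.1 hy]) hxy
      · intro g0 hg0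
        rw [mem_itrans] at hg0
        obtain ⟨k1, k2, k3⟩ := hg0
        have hc1 : (A a \ D.image g0).card = (A a).card - D.card := by
          rw [Finset.card_sdiff_of_subset, Finset.card_image_of_injOn]
          · exact k3.mono (by exact_mod_cast hDC)
          · intro s hs
            obtain ⟨c, hc, rfl⟩ := Finset.mem_image.1 hs
            have hc' := Finset.mem_filter.1 hc
            rw [← hA c (by simp [hc'.1]) a (by simp) hc'.2]
            exact k1 c hc'.1
        rw [← hc1]
        apply Finset.card_le_card_of_injOn (fun g => g a)
        · intro g hg
          obtain ⟨hg1, rfl⟩ := Finset.mem_filter.1 hg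
          rw [mem_itrans] at hg1
          obtain ⟨h1, h2, h3⟩ := hg1
          simp only [Finset.coe_sdiff, Set.mem_sdiff, Finset.mem_coe]
          refine ⟨h1 a (by simp), ?_⟩
          intro hm
          obtain ⟨c, hc, hca⟩ := Finset.mem_image.1 hm
          have hcC := hDC hc
          have hne : c ≠ a := by rintro rfl; exact ha hcC
          rw [Function.update_of_ne hne] at hca
          exact hne (h3 (by simp [hcC]) (by simp) hca)
        · intro g hg g' hg' hgg
          obtain ⟨hg1, e⟩ := Finset.mem_filter.1 hg
          obtain ⟨hg1', e'⟩ := Finset.mem_filter.1 hg'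
          funext x
          by_cases hx : x = a
          · subst hx; exact hgg
          · have := congrFun (e.trans e'.symm) x
            simpa [Function.update_of_ne hx] using this
    have e2 : ((B a).card - D.card) * (itrans C B).card ≤ (itrans (insert a C) B).card := by
      apply Finset.mul_card_image_le_card_of_maps_to (f := fun g => Function.update g a 0)
      · intro g hg
        rw [mem_itrans] at hg ⊢
        obtain ⟨h1, h2, h3⟩ := hg
        refine ⟨fun c hc => ?_, fun c hc => ?_, fun x hx y hy hxy => ?_⟩
        · rw [Function.update_of_ne (by rintro rfl; exact ha hc)]
          exact h1 c (by simp [hc])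
        · by_cases hca : c = a
          · simp [hca]
          · rw [Function.update_of_ne hca]; exact h2 c (by simp [hc, hca])
        · rw [Function.update_of_ne (by rintro rfl; exact ha hx),
            Function.update_of_ne (by rintro rfl; exact ha hy)] at hxy
          exact h3 (by simp [Finset.mem_coe.1 hx]) (by simp [Finset.mem_coe.1 hy]) hxy
      · intro g0 hg0
        rw [mem_itrans] at hg0
        obtain ⟨k1, k2, k3⟩ := hg0
        have hc1 : (B a).card - D.card ≤ (B a \ D.image g0).card := by
          have := Finset.le_card_sdiff (D.image g0) (B a)
          have := Finset.card_image_le (s := D) (f := g0)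
          omega
        refine hc1.trans ?_
        apply Finset.card_le_card_of_injOn (fun y => Function.update g0 a y)
        · intro y hy
          obtain ⟨hy1, hy2⟩ := Finset.mem_sdiff.1 hy
          have key : ∀ c ∈ C, g0 c ≠ y := by
            intro c hc hcy
            apply hy2
            refine Finset.mem_image.2 ⟨c, Finset.mem_filter.2 ⟨hc, ?_⟩, hcy⟩
            exact hB c (by simp [hc]) a (by simp) y (hcy ▸ k1 c hc) hy1
          have hne : ∀ c ∈ C, c ≠ a := by rintro c hc rfl; exact ha hc
          show Function.update g0 a y ∈ _
          refine Finset.mem_coe.2 (Finset.mem_filter.2 ⟨mem_itrans.2 ⟨?_, ?_, ?_⟩, ?_⟩)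
          · intro c hc
            by_cases hca : c = a
            · subst hca; simpa using hy1
            · rw [Function.update_of_ne hca]
              exact k1 c ((Finset.mem_insert.1 hc).resolve_left hca)
          · intro c hc
            simp only [Finset.mem_insert, not_or] at hc
            rw [Function.update_of_ne hc.1]
            exact k2 c hc.2
          · intro x hx z hz hxz
            have hx' := Finset.mem_insert.1 (Finset.mem_coe.1 hx)
            have hz' := Finset.mem_insert.1 (Finset.mem_coe.1 hz)
            rcases hx' with rfl | hx' <;> rcases hz' with rfl | hz'
            · rfl
            · rw [Function.update_self, Function.update_of_ne (hne z hz')] at hxz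
              exact absurd hxz.symm (key z hz')
            · rw [Function.update_self, Function.update_of_ne (hne x hx')] at hxz
              exact absurd hxz (key x hx')
            · rw [Function.update_of_ne (hne x hx'), Function.update_of_ne (hne z hz')] at hxz
              exact k3 hx' hz' hxz
          · funext x
            by_cases hx : x = a
            · subst hx; simp [k2 x ha]
            · simp [Function.update_of_ne hx]
        · intro y _ y' _ h
          simpa using congrFun h a
    calc _ ≤ _ := e1
      _ ≤ ((B a).card - D.card) * (itrans C B).card :=
        Nat.mul_le_mul (Nat.sub_le_sub_right (hAB a (by simp)) _) ih'
      _ ≤ _ := e2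

lemma card_unordered_le {β : Type*} [DecidableEq β] (sh : V → β) (A B : V → Finset ℕ)
    (C : Finset V)
    (hA : ∀ a ∈ C, ∀ b ∈ C, sh a = sh b → A a = A b)
    (hB : ∀ a ∈ C, ∀ b ∈ C, ∀ s, s ∈ B a → s ∈ B b → sh a = sh b)
    (hAB : ∀ c ∈ C, (A c).card ≤ (B c).card) :
    ((itrans C A).image (fun g => C.val.map g)).card ≤
      ((itrans C B).image (fun g => C.val.map g)).card := by
  classical
  have h0 := card_itrans_le sh A B C hA hB hAB
  set H : Finset (V → V) := Finset.univ.filter (fun f => Set.InjOn f C ∧ (∀ x ∈ C, f x ∈ C) ∧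
    (∀ x, x ∉ C → f x = x) ∧ ∀ x ∈ C, sh (f x) = sh x) with hH
  have hid : id ∈ H := by simp [hH, Set.injOn_id]
  have hpos : 0 < H.card := Finset.card_pos.2 ⟨_, hid⟩
  have e1 : H.card * ((itrans C A).image (fun g => C.val.map g)).card ≤ (itrans C A).card := by
    apply Finset.mul_card_image_le_card
    intro M hM
    obtain ⟨g0, hg0, rfl⟩ := Finset.mem_image.1 hM
    rw [mem_itrans] at hg0
    obtain ⟨k1, k2, k3⟩ := hg0
    apply Finset.card_le_card_of_injOn (fun f => g0 ∘ f)
    · intro f hf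
      obtain ⟨f1, f2, f3, f4⟩ := (Finset.mem_filter.1 hf).2
      have him : C.image f = C := by
        apply Finset.eq_of_subset_of_card_le
        · intro x hx
          obtain ⟨c, hc, rfl⟩ := Finset.mem_image.1 hx
          exact f2 c hc
        · rw [Finset.card_image_of_injOn f1]
      have hmap : C.val.map f = C.val := by
        rw [← Finset.image_val_of_injOn f1, him]
      refine Finset.mem_coe.2 (Finset.mem_filter.2 ⟨mem_itrans.2 ⟨?_, ?_, ?_⟩, ?_⟩)
      · intro c hc
        rw [← hA (f c) (f2 c hc) c hc (f4 c hc)]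
        exact k1 _ (f2 c hc)
      · intro c hc
        simp only [Function.comp, f3 c hc]
        exact k2 c hc
      · intro x hx y hy hxy
        exact f1 hx hy (k3 (f2 x hx) (f2 y hy) hxy)
      · show C.val.map (g0 ∘ f) = _
        rw [← Multiset.map_map, hmap]
    · intro f hf f' hf' hff
      obtain ⟨f1, f2, f3, f4⟩ := (Finset.mem_filter.1 hf).2
      obtain ⟨f1', f2', f3', f4'⟩ := (Finset.mem_filter.1 hf').2
      funext x
      by_cases hx : x ∈ C
      · exact k3 (f2 x hx) (f2' x hx) (congrFun hff x)
      · rw [f3 x hx, f3' x hx]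
  have e2 : (itrans C B).card ≤ H.card * ((itrans C B).image (fun g => C.val.map g)).card := by
    apply Finset.card_le_mul_card_image
    intro M hM
    obtain ⟨g0, hg0, rfl⟩ := Finset.mem_image.1 hM
    rw [mem_itrans] at hg0
    obtain ⟨k1, k2, k3⟩ := hg0
    have ex : ∀ g ∈ (itrans C B).filter (fun g => C.val.map g = C.val.map g0),
        ∃ f ∈ H, g = g0 ∘ f := by
      intro g hg
      obtain ⟨hg1, hg2⟩ := Finset.mem_filter.1 hg
      rw [mem_itrans] at hg1
      obtain ⟨h1, h2, h3⟩ := hg1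
      have : ∀ x, ∃ y, (x ∈ C → y ∈ C ∧ g0 y = g x) ∧ (x ∉ C → y = x) := by
        intro x
        by_cases hx : x ∈ C
        · have : g x ∈ C.val.map g0 := by
            rw [← hg2]; exact Multiset.mem_map_of_mem _ hx
          obtain ⟨y, hy, hyx⟩ := Multiset.mem_map.1 this
          exact ⟨y, fun _ => ⟨hy, hyx⟩, fun h => absurd hx h⟩
        · exact ⟨x, fun h => absurd h hx, fun _ => rfl⟩
      choose f hf1 hf2 using this
      refine ⟨f, Finset.mem_filter.2 ⟨Finset.mem_univ _, ?_, fun x hx => (hf1 x hx).1, hf2, ?_⟩, ?_⟩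
      · intro x hx y hy hxy
        apply h3 hx hy
        rw [← (hf1 x hx).2, ← (hf1 y hy).2, hxy]
      · intro x hx
        have h := hf1 x hx
        exact hB _ h.1 _ hx (g x) (h.2 ▸ k1 _ h.1) (h1 x hx)
      · funext x
        by_cases hx : x ∈ C
        · exact (hf1 x hx).2.symm
        · simp [hf2 x hx, h2 x hx, k2 x hx]
    have : Nonempty (V → V) := ⟨id⟩
    choose! F hF1 hF2 using ex
    apply Finset.card_le_card_of_injOn F
    · intro g hg; exact hF1 g hg
    · intro g hg g' hg' h
      rw [hF2 g hg, hF2 g' hg', h]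
  exact Nat.le_of_mul_le_mul_left (e1.trans (h0.trans e2)) hpos

end Comb

/-- rooted tree given by a parent function -/
structure RT (V : Type*) where
  r : V
  p : V → V
  d : V → ℕ
  hp : p r = r
  hd : ∀ x, x ≠ r → d x = d (p x) + 1

namespace RT
variable {V : Type*} [Fintype V] [DecidableEq V] (T : RT V)

def ch (v : V) : Finset V := Finset.univ.filter (fun x => x ≠ T.r ∧ T.p x = v)

lemma mem_ch {x v : V} : x ∈ T.ch v ↔ x ≠ T.r ∧ T.p x = v := by simp [ch]

lemma wf : WellFounded (fun c v => c ∈ T.ch v) := by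
  have h := (measure (fun v => (Finset.univ.sup T.d) - T.d v)).wf
  refine Subrelation.wf ?_ h
  intro c v hc
  obtain ⟨h1, h2⟩ := T.mem_ch.1 hc
  have h3 := T.hd c h1
  have h4 : T.d c ≤ Finset.univ.sup T.d := Finset.le_sup (Finset.mem_univ c)
  show Finset.univ.sup T.d - T.d c < Finset.univ.sup T.d - T.d v
  rw [h2] at h3
  omega

lemma up {P : V → Prop} (h : ∀ v, (∀ c ∈ T.ch v, P c) → P v) (v : V) : P v :=
  T.wf.induction v h

lemma wf' : WellFounded (fun y x => x ≠ T.r ∧ T.p x = y) := by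
  refine Subrelation.wf ?_ (measure T.d).wf
  rintro y x ⟨h1, rfl⟩
  show T.d (T.p x) < T.d x
  have := T.hd x h1; omega

lemma down {P : V → Prop} (h0 : P T.r) (h : ∀ x, x ≠ T.r → P (T.p x) → P x) (v : V) : P v := by
  refine T.wf'.induction v (fun x ih => ?_)
  by_cases hx : x = T.r
  · rw [hx]; exact h0
  · exact h x hx (ih _ ⟨hx, rfl⟩)

lemma exists_down {β : Type*} (b : β) (f : V → β → V → β) :
    ∃ K : V → β, K T.r = b ∧ ∀ x, x ≠ T.r → K x = f (T.p x) (K (T.p x)) x := by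
  refine ⟨T.wf'.fix (fun x rec => if h : x = T.r then b else f (T.p x) (rec (T.p x) ⟨h, rfl⟩) x),
    ?_, ?_⟩
  · rw [WellFounded.fix_eq]; simp
  · intro x hx
    conv_lhs => rw [WellFounded.fix_eq]
    simp [hx]

def enc (i : ℕ) (M : Multiset ℕ) : ℕ := Nat.pair i (Encodable.encode M)

lemma enc_inj {i j : ℕ} {M N : Multiset ℕ} (h : enc i M = enc j N) : i = j ∧ M = N := by
  have := Nat.pair_eq_pair.1 h
  exact ⟨this.1, Encodable.encode_injective this.2⟩

def col (s : ℕ) : ℕ := s.unpair.1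

@[simp] lemma col_enc (i : ℕ) (M : Multiset ℕ) : col (enc i M) = i := by simp [col, enc]

lemma exists_code (φ : V → ℕ) : ∃ K : V → ℕ, ∀ v, K v = enc (φ v) ((T.ch v).val.map K) := by
  refine ⟨T.wf.fix (fun v rec => enc (φ v) ((T.ch v).attach.val.map (fun c => rec c.1 c.2))), ?_⟩
  intro v
  conv_lhs => rw [WellFounded.fix_eq]
  congr 1
  rw [Finset.attach_val]
  exact Multiset.attach_map_val' (T.ch v).val _

def code (φ : V → ℕ) : V → ℕ := (T.exists_code φ).choose

lemma code_eq (φ : V → ℕ) (v : V) :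
    T.code φ v = enc (φ v) ((T.ch v).val.map (T.code φ)) := (T.exists_code φ).choose_spec v

inductive Good (L : V → Finset ℕ) : V → ℕ → Prop
  | mk (v : V) (i : ℕ) (g : V → ℕ) (hi : i ∈ L v) (hg : ∀ c ∈ T.ch v, Good L c (g c))
      (hne : ∀ c ∈ T.ch v, col (g c) ≠ i) (inj : Set.InjOn g (T.ch v)) :
      Good L v (enc i ((T.ch v).val.map g))

variable {T}

lemma Good.elim {L : V → Finset ℕ} {v : V} {s : ℕ} (h : T.Good L v s) :
    ∃ g : V → ℕ, col s ∈ L v ∧ (∀ c ∈ T.ch v, T.Good L c (g c)) ∧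
      (∀ c ∈ T.ch v, col (g c) ≠ col s) ∧ Set.InjOn g (T.ch v) ∧
      s = enc (col s) ((T.ch v).val.map g) := by
  cases h with
  | mk v i g hi hg hne inj => exact ⟨g, by simpa, hg, by simpa, inj, by simp⟩

variable (T)

lemma good_iff {L : V → Finset ℕ} (S : V → Finset ℕ) (v : V)
    (hS : ∀ c ∈ T.ch v, ∀ s, s ∈ S c ↔ T.Good L c s) (i : ℕ) (hi : i ∈ L v) (s : ℕ) :
    (T.Good L v s ∧ col s = i) ↔
    s ∈ ((itrans (T.ch v) (fun c => (S c).filter (fun t => col t ≠ i))).image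
      (fun g => (T.ch v).val.map g)).image (enc i) := by
  constructor
  · rintro ⟨h, rfl⟩
    obtain ⟨g, h1, h2, h3, h4, h5⟩ := h.elim
    have hmap : (T.ch v).val.map (fun c => if c ∈ T.ch v then g c else 0) =
        (T.ch v).val.map g := by
      apply Multiset.map_congr rfl
      intro x hx
      rw [if_pos (Finset.mem_def.2 hx)]
    refine Finset.mem_image.2 ⟨_, Finset.mem_image.2
      ⟨fun c => if c ∈ T.ch v then g c else 0, mem_itrans.2 ⟨?_, ?_, ?_⟩, rfl⟩, ?_⟩
    · intro c hc
      simp only [hc, if_true, Finset.mem_filter]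
      exact ⟨(hS c hc _).2 (h2 c hc), h3 c hc⟩
    · intro c hc; simp [hc]
    · intro x hx y hy hxy
      have hx' := Finset.mem_coe.1 hx
      have hy' := Finset.mem_coe.1 hy
      simp only [hx', hy', if_true] at hxy
      exact h4 hx hy hxy
    · show enc _ ((T.ch v).val.map _) = s
      rw [hmap]; exact h5.symm
  · intro h
    obtain ⟨M, hM, rfl⟩ := Finset.mem_image.1 h
    obtain ⟨g, hg, rfl⟩ := Finset.mem_image.1 hM
    obtain ⟨h1, h2, h3⟩ := mem_itrans.1 hg
    refine ⟨Good.mk v i g hi ?_ ?_ h3, by simp⟩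
    · intro c hc; exact (hS c hc _).1 (Finset.mem_filter.1 (h1 c hc)).1
    · intro c hc; exact (Finset.mem_filter.1 (h1 c hc)).2

lemma good_finite (L : V → Finset ℕ) (v : V) : {s | T.Good L v s}.Finite := by
  classical
  induction v using T.up with
  | _ v ih =>
  have : ∀ c, ∃ S : Finset ℕ, c ∈ T.ch v → ∀ s, s ∈ S ↔ T.Good L c s := by
    intro c
    by_cases hc : c ∈ T.ch v
    · exact ⟨(ih c hc).toFinset, fun _ s => by simp⟩
    · exact ⟨∅, fun h => absurd h hc⟩
  choose S hS using this
  refine Set.Finite.subset (Finset.finite_toSet ((L v).biUnion fun i =>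
    ((itrans (T.ch v) (fun c => (S c).filter (fun t => col t ≠ i))).image
      (fun g => (T.ch v).val.map g)).image (enc i))) ?_
  intro s hs
  have hi : col s ∈ L v := by
    obtain ⟨g, h1, _⟩ := Good.elim hs
    exact h1
  exact Finset.mem_coe.2 (Finset.mem_biUnion.2
    ⟨col s, hi, (T.good_iff S v hS (col s) hi s).1 ⟨hs, rfl⟩⟩)

def S (L : V → Finset ℕ) (v : V) : Finset ℕ := (T.good_finite L v).toFinset

lemma mem_S {L : V → Finset ℕ} {v : V} {s : ℕ} : s ∈ T.S L v ↔ T.Good L v s := by simp [S]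

lemma S_filter (L : V → Finset ℕ) (v : V) (i : ℕ) (hi : i ∈ L v) :
    (T.S L v).filter (fun s => col s = i) =
    ((itrans (T.ch v) (fun c => (T.S L c).filter (fun t => col t ≠ i))).image
      (fun g => (T.ch v).val.map g)).image (enc i) := by
  ext s
  rw [← T.good_iff (T.S L) v (fun _ _ _ => T.mem_S) i hi s]
  simp [mem_S]

lemma card_S_filter (L : V → Finset ℕ) (v : V) (i : ℕ) (hi : i ∈ L v) :
    ((T.S L v).filter (fun s => col s = i)).card =
    ((itrans (T.ch v) (fun c => (T.S L c).filter (fun t => col t ≠ i))).image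
      (fun g => (T.ch v).val.map g)).card := by
  rw [S_filter _ _ _ _ hi, Finset.card_image_of_injective]
  intro M N h
  exact (enc_inj h).2

lemma shape_of_common (L : V → Finset ℕ) (a : V) : ∀ b s, T.Good L a s → T.Good L b s →
    T.code 0 a = T.code 0 b := by
  induction a using T.up with
  | _ a ih =>
  intro b s ha hb
  obtain ⟨g, _, g2, _, _, g5⟩ := ha.elim
  obtain ⟨g', _, g2', _, _, g5'⟩ := hb.elim
  have hm := (enc_inj (g5.symm.trans g5')).2
  rw [T.code_eq, T.code_eq 0 b]
  congr 1
  rw [← Multiset.rel_eq, Multiset.rel_map] at hm ⊢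
  refine hm.mono ?_
  intro x hx y hy hxy
  exact ih x hx y (g x) (g2 x hx) (hxy ▸ g2' y hy)

lemma good_of_shape (A : Finset ℕ) (a : V) : ∀ b s, T.code 0 a = T.code 0 b →
    T.Good (fun _ => A) a s → T.Good (fun _ => A) b s := by
  induction a using T.up with
  | _ a ih =>
  intro b s hab ha
  obtain ⟨g, g1, g2, g3, g4, g5⟩ := ha.elim
  rw [T.code_eq, T.code_eq 0 b] at hab
  obtain ⟨f, hf, hf2⟩ := exists_match (T.code 0) (T.ch b) (T.ch a) (enc_inj hab).2.symm
  have hfm : ∀ x ∈ T.ch b, f x ∈ T.ch a := by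
    intro x hx
    rw [← Finset.mem_val, ← hf]
    exact Multiset.mem_map_of_mem _ hx
  have hfi : Set.InjOn f (T.ch b) := by
    intro x hx y hy hxy
    exact Multiset.inj_on_of_nodup_map (hf ▸ (T.ch a).nodup) x hx y hy hxy
  have : s = enc (col s) ((T.ch b).val.map (g ∘ f)) := by
    rw [← Multiset.map_map, hf]; exact g5
  rw [this]
  refine Good.mk b (col s) (g ∘ f) g1 ?_ ?_ ?_
  · intro c hc
    exact ih (f c) (hfm c hc) c _ (hf2 c hc) (g2 _ (hfm c hc))
  · intro c hc; exact g3 _ (hfm c hc)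
  · intro x hx y hy hxy
    exact hfi hx hy (g4 (hfm x hx) (hfm y hy) hxy)

lemma col_mem {L : V → Finset ℕ} {v : V} {s : ℕ} (h : s ∈ T.S L v) : col s ∈ L v := by
  obtain ⟨g, h1, _⟩ := (T.mem_S.1 h).elim
  exact h1

lemma card_ne (L : V → Finset ℕ) (v : V) (i : ℕ) :
    ((T.S L v).filter (fun s => col s ≠ i)).card =
    ∑ j ∈ (L v).erase i, ((T.S L v).filter (fun s => col s = j)).card := by
  rw [Finset.card_eq_sum_card_fiberwise (f := col) (t := (L v).erase i)]
  · apply Finset.sum_congr rfl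
    intro j hj
    congr 1
    ext s
    simp only [Finset.mem_filter]
    constructor
    · rintro ⟨⟨h1, h2⟩, h3⟩; exact ⟨h1, h3⟩
    · rintro ⟨h1, rfl⟩; exact ⟨⟨h1, Finset.ne_of_mem_erase hj⟩, rfl⟩
  · intro s hs
    obtain ⟨h1, h2⟩ := Finset.mem_filter.1 (Finset.mem_coe.1 hs)
    exact Finset.mem_coe.2 (Finset.mem_erase.2 ⟨h2, T.col_mem h1⟩)

lemma main_ind (k : ℕ) (L : V → Finset ℕ) (hL : ∀ v, (L v).card = k) (v : V) :
    ∀ i ∈ Finset.range k, ∀ j ∈ L v,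
    ((T.S (fun _ => Finset.range k) v).filter (fun s => col s = i)).card ≤
    ((T.S L v).filter (fun s => col s = j)).card := by
  induction v using T.up with
  | _ v ih =>
  intro i hi j hj
  rw [T.card_S_filter _ v i hi, T.card_S_filter _ v j hj]
  apply card_unordered_le (T.code 0)
  · intro a _ b _ hab
    ext s
    simp only [Finset.mem_filter, mem_S]
    exact and_congr_left fun _ => ⟨T.good_of_shape _ a b s hab, T.good_of_shape _ b a s hab.symm⟩
  · intro a _ b _ s ha hb
    simp only [Finset.mem_filter, mem_S] at ha hb
    exact T.shape_of_common L a b s ha.1 hb.1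
  · intro c hc
    rw [T.card_ne, T.card_ne]
    have hcard : ((Finset.range k).erase i).card ≤ ((L c).erase j).card := by
      rw [Finset.card_erase_of_mem hi, Finset.card_range, ← hL c]
      exact Finset.pred_card_le_card_erase
    obtain ⟨E, hE, hE2⟩ := Finset.exists_subset_card_eq hcard
    obtain e := Finset.equivOfCardEq hE2.symm
    calc _ ≤ ∑ l ∈ E, ((T.S L c).filter (fun s => col s = l)).card := by
          rw [← Finset.sum_coe_sort, ← Finset.sum_coe_sort E, ← e.sum_comp]
          apply Finset.sum_le_sum
          intro x _
          exact ih c hc x.1 (Finset.mem_of_mem_erase x.2) _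
            (Finset.mem_of_mem_erase (hE (e x).2))
      _ ≤ _ := Finset.sum_le_sum_of_subset hE

lemma exists_good (k : ℕ) (L : V → Finset ℕ) (hL : ∀ v, (L v).card = k) (v : V) (s : ℕ)
    (h : T.Good (fun _ => Finset.range k) v s) : ∃ s', T.Good L v s' := by
  have h1 := T.col_mem (T.mem_S.2 h)
  have hk : 0 < k := by have := Finset.mem_range.1 h1; omega
  obtain ⟨j, hj⟩ := Finset.card_pos.1 (by rw [hL v]; exact hk)
  have h2 := T.main_ind k L hL v _ h1 j hj
  have h3 : 0 < ((T.S (fun _ => Finset.range k) v).filter (fun t => col t = col s)).card :=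
    Finset.card_pos.2 ⟨s, Finset.mem_filter.2 ⟨T.mem_S.2 h, rfl⟩⟩
  obtain ⟨t, ht⟩ := Finset.card_pos.1 (h3.trans_le h2)
  exact ⟨t, T.mem_S.1 (Finset.mem_filter.1 ht).1⟩

lemma realize (L : V → Finset ℕ) (s : ℕ) (h : T.Good L T.r s) :
    ∃ φ : V → ℕ, (∀ v, φ v ∈ L v) ∧ (∀ x, x ≠ T.r → φ x ≠ φ (T.p x)) ∧
      ∀ σ : V → V, Function.Injective σ → σ T.r = T.r → (∀ x, T.p (σ x) = σ (T.p x)) →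
        (∀ x, φ (σ x) = φ x) → ∀ x, σ x = x := by
  have step : ∀ (v : V) (s : ℕ), ∃ g : V → ℕ, T.Good L v s → 
      col s ∈ L v ∧ (∀ c ∈ T.ch v, T.Good L c (g c)) ∧
      (∀ c ∈ T.ch v, col (g c) ≠ col s) ∧ Set.InjOn g (T.ch v) ∧
      s = enc (col s) ((T.ch v).val.map g) := by
    intro v s
    by_cases h : T.Good L v s
    · obtain ⟨g, hg⟩ := h.elim
      exact ⟨g, fun _ => hg⟩
    · exact ⟨0, fun h' => absurd h' h⟩
  choose G hG using step
  obtain ⟨K, hK0, hK⟩ := T.exists_down s G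
  have hgood : ∀ v, T.Good L v (K v) := by
    intro v
    induction v using T.down with
    | h0 => rw [hK0]; exact h
    | h x hx ih =>
      rw [hK x hx]
      exact (hG _ _ ih).2.1 x (T.mem_ch.2 ⟨hx, rfl⟩)
  have hKc : ∀ v, ∀ c ∈ T.ch v, K c = G v (K v) c := by
    intro v c hc
    obtain ⟨h1, rfl⟩ := T.mem_ch.1 hc
    exact hK c h1
  have hrec : ∀ v, K v = enc (col (K v)) ((T.ch v).val.map K) := by
    intro v
    conv_lhs => rw [(hG _ _ (hgood v)).2.2.2.2]
    congr 1
    apply Multiset.map_congr rfl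
    intro x hx
    exact (hKc v x hx).symm
  refine ⟨fun v => col (K v), fun v => (hG _ _ (hgood v)).1, ?_, ?_⟩
  · intro x hx
    have hc := T.mem_ch.2 ⟨hx, rfl⟩
    have := (hG _ _ (hgood (T.p x))).2.2.1 x hc
    rw [← hKc _ _ hc] at this
    exact this
  · intro σ hinj hr hp hφ
    have hφ : ∀ x, col (K (σ x)) = col (K x) := hφ
    have hσr : ∀ x, σ x = T.r ↔ x = T.r :=
      fun x => ⟨fun h => hinj (h.trans hr.symm), fun h => by rw [h, hr]⟩
    have hsurj : Function.Surjective σ := Finite.surjective_of_injective hinj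
    have hch : ∀ v, T.ch (σ v) = (T.ch v).image σ := by
      intro v
      ext y
      obtain ⟨x, rfl⟩ := hsurj y
      rw [Finset.mem_image, mem_ch, hp]
      constructor
      · rintro ⟨h1, h2⟩
        exact ⟨x, T.mem_ch.2 ⟨fun h => h1 ((hσr x).2 h), hinj h2⟩, rfl⟩
      · rintro ⟨z, hz, hzx⟩
        obtain rfl := hinj hzx
        obtain ⟨h1, h2⟩ := T.mem_ch.1 hz
        exact ⟨fun h => h1 ((hσr _).1 h), by rw [h2]⟩
    have hKσ : ∀ v, K (σ v) = K v := by
      intro v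
      induction v using T.up with
      | _ v ih =>
      rw [hrec (σ v), hrec v, hφ v, hch, Finset.image_val_of_injOn hinj.injOn, Multiset.map_map]
      congr 1
      exact Multiset.map_congr rfl ih
    intro x
    induction x using T.down with
    | h0 => exact hr
    | h x hx ih =>
      have h1 : x ∈ T.ch (T.p x) := T.mem_ch.2 ⟨hx, rfl⟩
      have h2 : σ x ∈ T.ch (T.p x) := T.mem_ch.2 ⟨fun h => hx ((hσr x).1 h), by rw [hp, ih]⟩
      apply (hG _ _ (hgood (T.p x))).2.2.2.1 h2 h1
      rw [← hKc _ _ h1, ← hKc _ _ h2, hKσ]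

lemma good_of_dist (k : ℕ) (φ : V → ℕ) (hk : ∀ v, φ v < k)
    (hpr : ∀ x, x ≠ T.r → φ x ≠ φ (T.p x))
    (hdist : ∀ σ : V → V, Function.Injective σ → σ T.r = T.r → (∀ x, T.p (σ x) = σ (T.p x)) →
        (∀ x, φ (σ x) = φ x) → ∀ x, σ x = x) :
    T.Good (fun _ => Finset.range k) T.r (T.code φ T.r) := by
  have hcol : ∀ v, col (T.code φ v) = φ v := fun v => by rw [T.code_eq]; simp
  have hinj : ∀ q, Set.InjOn (T.code φ) (T.ch q) := by
    intro q u hu w hw huw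
    by_contra hne
    have hu' := Finset.mem_coe.1 hu
    have hw' := Finset.mem_coe.1 hw
    have ex : ∀ a b, ∃ m : V → V, (T.code φ a = T.code φ b → (∀ x ∈ T.ch a, m x ∈ T.ch b) ∧
        (∀ x ∈ T.ch a, T.code φ (m x) = T.code φ x) ∧ Set.InjOn m (T.ch a)) ∧
        (a = b → a ≠ q → m = id) ∧ (a = q → b = q → m = Equiv.swap u w) := by
      intro a b
      by_cases hab : a = b
      · subst hab
        by_cases haq : a = q
        · subst haq
          refine ⟨Equiv.swap u w, fun _ => ⟨?_, ?_, (Equiv.injective _).injOn⟩,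
            fun _ h => absurd rfl h, fun _ _ => rfl⟩
          · intro x hx
            rcases eq_or_ne x u with rfl | hxu
            · simpa using hw'
            · rcases eq_or_ne x w with rfl | hxw
              · simpa using hu'
              · rwa [Equiv.swap_apply_of_ne_of_ne hxu hxw]
          · intro x hx
            rcases eq_or_ne x u with rfl | hxu
            · simpa using huw.symm
            · rcases eq_or_ne x w with rfl | hxw
              · simpa using huw
              · rw [Equiv.swap_apply_of_ne_of_ne hxu hxw]
        · exact ⟨id, fun _ => ⟨fun x hx => hx, fun x _ => rfl, Set.injOn_id _⟩, fun _ _ => rfl,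
            fun h => absurd h haq⟩
      · by_cases hc : T.code φ a = T.code φ b
        · have hc' := hc
          rw [T.code_eq, T.code_eq φ b] at hc'
          obtain ⟨f, hf, hf2⟩ := exists_match (T.code φ) (T.ch a) (T.ch b) (enc_inj hc').2
          refine ⟨f, fun _ => ⟨?_, hf2, ?_⟩, fun h => absurd h hab,
            fun h h' => absurd (h.trans h'.symm) hab⟩
          · intro x hx
            rw [← Finset.mem_val, ← hf]
            exact Multiset.mem_map_of_mem _ hx
          · intro x hx y hy hxy
            exact Multiset.inj_on_of_nodup_map (hf ▸ (T.ch b).nodup) x hx y hy hxy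
        · exact ⟨id, fun h => absurd h hc, fun h => absurd h hab,
            fun h h' => absurd (h.trans h'.symm) hab⟩
    choose m hm1 hm2 hm3 using ex
    obtain ⟨σ, hσ0, hσ⟩ := T.exists_down T.r (fun a b x => m a b x)
    have hself : ∀ x, x ≠ T.r → x ∈ T.ch (T.p x) := fun x hx => T.mem_ch.2 ⟨hx, rfl⟩
    have hcode : ∀ x, T.code φ (σ x) = T.code φ x := by
      intro x
      induction x using T.down with
      | h0 => rw [hσ0]
      | h x hx ih =>
        rw [hσ x hx]
        exact (hm1 _ _ ih.symm).2.1 x (hself x hx)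
    have hmem : ∀ x, x ≠ T.r → σ x ∈ T.ch (σ (T.p x)) := by
      intro x hx
      rw [hσ x hx]
      exact (hm1 _ _ (hcode _).symm).1 x (hself x hx)
    have hp : ∀ x, T.p (σ x) = σ (T.p x) := by
      intro x
      by_cases hx : x = T.r
      · rw [hx, hσ0, T.hp, hσ0]
      · exact (T.mem_ch.1 (hmem x hx)).2
    have hnr : ∀ x, x ≠ T.r → σ x ≠ T.r := fun x hx => (T.mem_ch.1 (hmem x hx)).1
    have hσi : Function.Injective σ := by
      intro x
      induction x using T.down with
      | h0 =>
        intro y hy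
        by_contra h
        exact hnr y (fun h' => h h'.symm) (by rw [← hy, hσ0])
      | h x hx ih =>
        intro y hy
        have hy0 : y ≠ T.r := by
          rintro rfl
          exact hnr x hx (by rw [hy, hσ0])
        have h1 : T.p x = T.p y := ih (by rw [← hp, ← hp, hy])
        have hy1 := hσ y hy0
        rw [← h1] at hy1
        refine (hm1 _ _ (hcode (T.p x)).symm).2.2 (hself x hx) (h1 ▸ hself y hy0) ?_
        rw [← hσ x hx, hy, hy1]
    have hφ : ∀ x, φ (σ x) = φ x := fun x => by rw [← hcol, hcode, hcol]
    have hall := hdist σ hσi hσ0 hp hφ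
    obtain ⟨hu0, hu1⟩ := T.mem_ch.1 hu'
    have h1 := hσ u hu0
    rw [hu1, hall q, hall u, hm3 q q rfl rfl, Equiv.swap_apply_left] at h1
    exact hne h1
  have : ∀ v, T.Good (fun _ => Finset.range k) v (T.code φ v) := by
    intro v
    induction v using T.up with
    | _ v ih =>
    rw [T.code_eq]
    refine Good.mk v (φ v) (T.code φ) (Finset.mem_range.2 (hk v)) ih ?_ (hinj v)
    intro c hc
    obtain ⟨h1, rfl⟩ := T.mem_ch.1 hc
    rw [hcol]
    exact hpr c h1
  exact this _

end RT

lemma tree_parent_exists {V : Type*} (G : SimpleGraph V) (hG : G.IsTree) (r x : V) (hx : x ≠ r) :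
    ∃ y, G.Adj x y ∧ G.dist x r = G.dist y r + 1 := by
  obtain ⟨w, hw⟩ := hG.connected.exists_walk_length_eq_dist x r
  cases w with
  | nil => exact absurd rfl hx
  | cons h q =>
    rename_i y
    refine ⟨y, h, ?_⟩
    rw [SimpleGraph.Walk.length_cons] at hw
    have h1 := SimpleGraph.dist_le q
    have h2 := hG.dist_eq_dist_add_one_of_adj r h
    rw [G.dist_comm (u := r) (v := x), G.dist_comm (u := r) (v := y)] at h2
    omega

lemma tree_parent_unique {V : Type*} (G : SimpleGraph V) (hG : G.IsTree) (r x y z : V)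
    (hy : G.Adj x y ∧ G.dist x r = G.dist y r + 1) (hz : G.Adj x z ∧ G.dist x r = G.dist z r + 1) :
    y = z := by
  obtain ⟨q, hq⟩ := hG.connected.exists_walk_length_eq_dist y r
  obtain ⟨q', hq'⟩ := hG.connected.exists_walk_length_eq_dist z r
  have h1 : (SimpleGraph.Walk.cons hy.1 q).IsPath :=
    SimpleGraph.Walk.isPath_of_length_eq_dist _ (by simp [hq, hy.2])
  have h2 : (SimpleGraph.Walk.cons hz.1 q').IsPath :=
    SimpleGraph.Walk.isPath_of_length_eq_dist _ (by simp [hq', hz.2])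
  have h3 := (hG.existsUnique_path x r).unique h1 h2
  have := congrArg SimpleGraph.Walk.snd h3
  simpa using this

lemma iso_dist_le {V : Type*} (G : SimpleGraph V) (hG : G.IsTree) (σ : G ≃g G) (a b : V) :
    G.dist (σ a) (σ b) ≤ G.dist a b := by
  obtain ⟨w, hw⟩ := hG.connected.exists_walk_length_eq_dist a b
  have := SimpleGraph.dist_le (w.map σ.toHom)
  rw [SimpleGraph.Walk.length_map, hw] at this
  exact this

lemma iso_dist {V : Type*} (G : SimpleGraph V) (hG : G.IsTree) (σ : G ≃g G) (a b : V) :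
    G.dist (σ a) (σ b) = G.dist a b := by
  apply le_antisymm (iso_dist_le G hG σ a b)
  have := iso_dist_le G hG σ.symm (σ a) (σ b)
  simpa using this

lemma exists_RT {V : Type*} (G : SimpleGraph V) (hG : G.IsTree) (r : V) :
    ∃ T : RT V, T.r = r ∧ (∀ a b, G.Adj a b ↔ (a ≠ r ∧ T.p a = b) ∨ (b ≠ r ∧ T.p b = a)) ∧
      ∀ σ : G ≃g G, σ r = r → ∀ x, T.p (σ x) = σ (T.p x) := by
  classical
  have : ∀ x, ∃ y, (x = r → y = r) ∧ (x ≠ r → G.Adj x y ∧ G.dist x r = G.dist y r + 1) := by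
    intro x
    by_cases hx : x = r
    · exact ⟨r, fun _ => rfl, fun h => absurd hx h⟩
    · obtain ⟨y, hy⟩ := tree_parent_exists G hG r x hx
      exact ⟨y, fun h => absurd h hx, fun _ => hy⟩
  choose p hp1 hp2 using this
  have hu : ∀ x y, G.Adj x y → G.dist x r = G.dist y r + 1 → x ≠ r ∧ p x = y := by
    intro x y h1 h2
    have hx : x ≠ r := by rintro rfl; simp at h2
    exact ⟨hx, tree_parent_unique G hG r x _ _ (hp2 x hx) ⟨h1, h2⟩⟩
  refine ⟨⟨r, p, fun x => G.dist x r, hp1 r rfl, fun x hx => (hp2 x hx).2⟩, rfl, ?_, ?_⟩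
  · intro a b
    constructor
    · intro h
      have h2 := hG.dist_eq_dist_add_one_of_adj r h
      rw [G.dist_comm (u := r) (v := a), G.dist_comm (u := r) (v := b)] at h2
      rcases h2 with h2 | h2
      · exact Or.inl (hu a b h h2)
      · exact Or.inr (hu b a h.symm h2)
    · rintro (⟨h1, h2⟩ | ⟨h1, h2⟩)
      · exact h2 ▸ (hp2 a h1).1
      · exact h2 ▸ (hp2 b h1).1.symm
  · intro σ hσ x
    show p (σ x) = σ (p x)
    by_cases hx : x = r
    · rw [hx, hσ, hp1 r rfl, hσ]
    · obtain ⟨h1, h2⟩ := hp2 x hx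
      refine (hu (σ x) (σ (p x)) (σ.map_rel_iff.2 h1) ?_).2
      have e1 := iso_dist G hG σ x r
      have e2 := iso_dist G hG σ (p x) r
      rw [hσ] at e1 e2
      rw [e1, e2, h2]

theorem stmt13 {V : Type*} [Fintype V] (G : SimpleGraph V) (hG : G.IsTree)
    (r : V) : chiD G r = chiDL G r := by
  classical
  unfold chiD chiDL
  congr 1
  ext k
  simp only [Set.mem_ofPred_eq]
  constructor
  · rintro ⟨φ, hpr, hd⟩ L hL
    obtain ⟨T, rfl, hadj, haut⟩ := exists_RT G hG r
    have hgood := T.good_of_dist k (fun v => (φ v : ℕ)) (fun v => (φ v).2)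
      (fun x hx h => hpr x (T.p x) ((hadj _ _).2 (Or.inl ⟨hx, rfl⟩)) (Fin.ext h)) ?_
    · obtain ⟨s, hs⟩ := T.exists_good k L hL _ _ hgood
      obtain ⟨ψ, h1, h2, h3⟩ := T.realize L s hs
      refine ⟨ψ, h1, ?_, ?_⟩
      · intro a b hab
        rcases (hadj a b).1 hab with ⟨ha, rfl⟩ | ⟨hb, rfl⟩
        · exact h2 a ha
        · exact (h2 b hb).symm
      · intro σ hσ hψ
        exact h3 σ σ.injective hσ (haut σ hσ) hψ
    · intro σ hinj hr hp hφ
      have hbij : Function.Bijective σ := Finite.injective_iff_bijective.1 hinj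
      have hσr : ∀ x, σ x = T.r ↔ x = T.r :=
        fun x => ⟨fun h => hinj (h.trans hr.symm), fun h => by rw [h, hr]⟩
      let τ : G ≃g G :=
        { toEquiv := Equiv.ofBijective σ hbij
          map_rel_iff' := by
            intro a b
            simp only [Equiv.ofBijective_apply]
            rw [hadj, hadj, hp, hp, hinj.eq_iff, hinj.eq_iff, ne_eq, ne_eq, hσr, hσr] }
      intro x
      exact hd τ hr (fun w => Fin.ext (hφ w)) x
  · intro h
    obtain ⟨ψ, h1, h2, h3⟩ := h (fun _ => Finset.range k) (fun _ => Finset.card_range k)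
    refine ⟨fun v => ⟨ψ v, Finset.mem_range.1 (h1 v)⟩, ?_, ?_⟩
    · intro a b hab he
      exact h2 a b hab (congrArg Fin.val he)
    · intro σ hσ hw
      exact h3 σ hσ (fun w => congrArg Fin.val (hw w))
end
end

section
/- For every tree T (unrooted), the distinguishing chromatic number equals the list distinguishing chromatic number: χ_D(T) = χ_{D_ℓ}(T). -/
open SimpleGraph

noncomputable section

namespace S14

open Finset

/-- sets of distinct representatives -/
def SDR {V : Type*} (A : V → Finset ℕ) (I : Finset V) : Finset (Finset ℕ) := by
  classical
  exact (I.biUnion A).powerset.filter fun M =>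
    ∃ c : V → ℕ, Set.InjOn c I ∧ (∀ u ∈ I, c u ∈ A u) ∧ I.image c = M

lemma mem_SDR {V : Type*} {A : V → Finset ℕ} {I : Finset V} {M : Finset ℕ} :
    M ∈ SDR A I ↔
      ∃ c : V → ℕ, Set.InjOn c I ∧ (∀ u ∈ I, c u ∈ A u) ∧ I.image c = M := by
  classical
  unfold SDR
  rw [mem_filter, mem_powerset]
  refine ⟨fun h => h.2, fun h => ⟨?_, h⟩⟩
  obtain ⟨c, _, h2, rfl⟩ := h
  intro x hx
  obtain ⟨u, hu, rfl⟩ := mem_image.1 hx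
  exact mem_biUnion.2 ⟨u, hu, h2 u hu⟩

lemma SDR_subset {V : Type*} {A : V → Finset ℕ} {I : Finset V} {M : Finset ℕ}
    (h : M ∈ SDR A I) {x : ℕ} (hx : x ∈ M) : ∃ u ∈ I, x ∈ A u := by
  obtain ⟨c, _, h2, rfl⟩ := mem_SDR.1 h
  obtain ⟨u, hu, rfl⟩ := mem_image.1 hx
  exact ⟨u, hu, h2 u hu⟩

lemma sdr_le {V ι : Type*} (sh : V → ι) (n : ℕ) : ∀ (I : Finset V) (A B : V → Finset ℕ),
    (I.biUnion B).card ≤ n →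
    (∀ u ∈ I, (B u).card ≤ (A u).card) →
    (∀ u ∈ I, ∀ v ∈ I, sh u = sh v → B u = B v) →
    (∀ u ∈ I, ∀ v ∈ I, sh u ≠ sh v → Disjoint (A u) (A v)) →
    (∀ u ∈ I, ∀ v ∈ I, sh u ≠ sh v → Disjoint (B u) (B v)) →
    (SDR B I).card ≤ (SDR A I).card := by
  classical
  induction n with
  | zero =>
    intro I A B h0 _ _ _ _
    have hB : ∀ u ∈ I, B u = ∅ := by
      intro u hu
      have : I.biUnion B = ∅ := by simpa using h0
      ext x
      constructor
      · intro hx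
        rw [← this]
        exact mem_biUnion.2 ⟨u, hu, hx⟩
      · simp
    rcases I.eq_empty_or_nonempty with rfl | ⟨w, hw⟩
    · apply card_le_card
      intro M hM
      rw [mem_SDR] at hM ⊢
      obtain ⟨c, _, _, h⟩ := hM
      exact ⟨c, by simp, by simp, h⟩
    · have : SDR B I = ∅ := by
        ext M
        simp only [notMem_empty, iff_false, mem_SDR]
        rintro ⟨c, _, h, _⟩
        have := h w hw
        rw [hB w hw] at this
        simp at this
      simp [this]
  | succ n ih =>
    intro I A B h0 hc hB dA dB
    rcases I.eq_empty_or_nonempty with rfl | ⟨w, hw⟩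
    · apply card_le_card
      intro M hM
      rw [mem_SDR] at hM ⊢
      obtain ⟨c, _, _, h⟩ := hM
      exact ⟨c, by simp, by simp, h⟩
    rcases (B w).eq_empty_or_nonempty with hBw | ⟨y, hy⟩
    · have : SDR B I = ∅ := by
        ext M
        simp only [notMem_empty, iff_false, mem_SDR]
        rintro ⟨c, _, h, _⟩
        have := h w hw
        rw [hBw] at this
        simp at this
      simp [this]
    obtain ⟨x, hx⟩ : (A w).Nonempty := by
      rw [← card_pos]
      exact lt_of_lt_of_le (card_pos.2 ⟨y, hy⟩) (hc w hw)
    set A' : V → Finset ℕ := fun u => (A u).erase x with hA'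
    set B' : V → Finset ℕ := fun u => (B u).erase y with hB'
    have key : ∀ J ⊆ I, (SDR B' J).card ≤ (SDR A' J).card := by
      intro J hJ
      apply ih J A' B'
      · have : J.biUnion B' ⊆ (I.biUnion B).erase y := by
          intro z hz
          obtain ⟨u, hu, hz⟩ := mem_biUnion.1 hz
          rw [hB', mem_erase] at hz
          exact mem_erase.2 ⟨hz.1, mem_biUnion.2 ⟨u, hJ hu, hz.2⟩⟩
        have h1 := card_le_card this
        rw [card_erase_of_mem (mem_biUnion.2 ⟨w, hw, hy⟩)] at h1
        omega
      · intro u hu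
        have hcu := hc u (hJ hu)
        by_cases hs : sh u = sh w
        · have : y ∈ B u := by rw [hB u (hJ hu) w hw hs]; exact hy
          simp only [hA', hB']
          rw [card_erase_of_mem this]
          have := pred_card_le_card_erase (s := A u) (a := x)
          omega
        · have : x ∉ A u := fun h => disjoint_left.1 (dA u (hJ hu) w hw hs) h hx
          simp only [hA', hB']
          rw [erase_eq_of_notMem this]
          exact le_trans (card_le_card (erase_subset _ _)) hcu
      · intro u hu v hv h
        simp only [hB', hB u (hJ hu) v (hJ hv) h]
      · intro u hu v hv h
        exact (dA u (hJ hu) v (hJ hv) h).mono (erase_subset _ _) (erase_subset _ _)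
      · intro u hu v hv h
        exact (dB u (hJ hu) v (hJ hv) h).mono (erase_subset _ _) (erase_subset _ _)
    have hBsub : SDR B I ⊆ SDR B' I ∪ (SDR B' (I.erase w)).image (insert y) := by
      intro M hM
      obtain ⟨c, c1, c2, rfl⟩ := mem_SDR.1 hM
      by_cases hyM : y ∈ I.image c
      · apply mem_union_right
        obtain ⟨u, hu, hcu⟩ := mem_image.1 hyM
        have hsu : sh u = sh w := by
          by_contra h
          exact disjoint_left.1 (dB u hu w hw h) (hcu ▸ c2 u hu) hy
        have hBu := hB u hu w hw hsu
        refine mem_image.2 ⟨(I.erase u).image c, mem_SDR.2 ⟨fun z => if z = u then c w else c z, ?_, ?_, ?_⟩, ?_⟩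
        · intro a ha b hb hab
          simp only [coe_erase, Set.mem_sdiff, mem_coe, Set.mem_singleton_iff] at ha hb
          simp only at hab
          split_ifs at hab with h1 h2 h2
          · rw [h1, h2]
          · exact absurd (c1 hw hb.1 hab).symm hb.2
          · exact absurd (c1 ha.1 hw hab) ha.2
          · exact c1 ha.1 hb.1 hab
        · intro a ha
          rw [mem_erase] at ha
          simp only [hB', mem_erase]
          split_ifs with h1
          · subst h1
            refine ⟨fun h => ha.1 (c1 ha.2 hw (by rw [h, hcu])), ?_⟩
            rw [hBu]; exact c2 w hw
          · exact ⟨fun h => h1 (c1 ha.2 hu (by rw [h, hcu])), c2 a ha.2⟩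
        · ext z
          simp only [mem_image, mem_erase]
          constructor
          · rintro ⟨a, ⟨ha, haI⟩, rfl⟩
            split_ifs with h1
            · exact ⟨w, ⟨fun h => ha (h1.trans h.symm), hw⟩, rfl⟩
            · exact ⟨a, ⟨h1, haI⟩, rfl⟩
          · rintro ⟨a, ⟨ha, haI⟩, rfl⟩
            by_cases h : a = w
            · subst h
              exact ⟨u, ⟨Ne.symm ha, hu⟩, by simp⟩
            · exact ⟨a, ⟨h, haI⟩, by simp [ha]⟩
        · rw [← hcu, ← image_insert, insert_erase hu]
      · apply mem_union_left
        refine mem_SDR.2 ⟨c, c1, fun u hu => mem_erase.2 ⟨fun h => hyM (mem_image.2 ⟨u, hu, h⟩), c2 u hu⟩, rfl⟩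
    have hx1 : ∀ J, ∀ M ∈ SDR A' J, x ∉ M := by
      intro J M hM hxM
      obtain ⟨u, _, h⟩ := SDR_subset hM hxM
      simp [hA'] at h
    have hAsub : SDR A' I ∪ (SDR A' (I.erase w)).image (insert x) ⊆ SDR A I := by
      intro M hM
      rcases mem_union.1 hM with hM | hM
      · obtain ⟨c, c1, c2, rfl⟩ := mem_SDR.1 hM
        exact mem_SDR.2 ⟨c, c1, fun u hu => (mem_erase.1 (c2 u hu)).2, rfl⟩
      · obtain ⟨M₁, hM₁, rfl⟩ := mem_image.1 hM
        obtain ⟨c, c1, c2, rfl⟩ := mem_SDR.1 hM₁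
        refine mem_SDR.2 ⟨fun z => if z = w then x else c z, ?_, ?_, ?_⟩
        · intro a ha b hb hab
          simp only at hab
          have hne : ∀ a ∈ I, a ≠ w → c a ≠ x := fun a ha h =>
            (mem_erase.1 (c2 a (mem_erase.2 ⟨h, ha⟩))).1
          split_ifs at hab with h1 h2 h2
          · rw [h1, h2]
          · exact absurd hab.symm (hne b hb h2)
          · exact absurd hab (hne a ha h1)
          · exact c1 (mem_coe.2 (mem_erase.2 ⟨h1, ha⟩)) (mem_coe.2 (mem_erase.2 ⟨h2, hb⟩)) hab
        · intro a ha
          dsimp only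
          split_ifs with h1
          · rw [h1]; exact hx
          · exact (mem_erase.1 (c2 a (mem_erase.2 ⟨h1, ha⟩))).2
        · conv_lhs => rw [← insert_erase hw]
          rw [image_insert]
          simp only [if_true]
          congr 1
          apply image_congr
          intro a ha
          simp only [coe_erase, Set.mem_sdiff, mem_coe, Set.mem_singleton_iff] at ha
          simp [ha.2]
    have hdis : Disjoint (SDR A' I) ((SDR A' (I.erase w)).image (insert x)) := by
      rw [Finset.disjoint_left]
      intro M hM h
      obtain ⟨M', _, rfl⟩ := mem_image.1 h
      exact hx1 _ _ hM (mem_insert_self _ _)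
    calc (SDR B I).card ≤ _ := card_le_card hBsub
      _ ≤ (SDR B' I).card + ((SDR B' (I.erase w)).image (insert y)).card := card_union_le _ _
      _ ≤ (SDR B' I).card + (SDR B' (I.erase w)).card := Nat.add_le_add_left card_image_le _
      _ ≤ (SDR A' I).card + (SDR A' (I.erase w)).card := 
          Nat.add_le_add (key I subset_rfl) (key _ (erase_subset _ _))
      _ = (SDR A' I).card + ((SDR A' (I.erase w)).image (insert x)).card := by
          congr 1
          rw [card_image_of_injOn]
          intro M hM M' hM' h
          have h1 := hx1 _ _ hM
          have h2 := hx1 _ _ hM'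
          have := congrArg (fun s => s.erase x) h
          simpa [erase_insert h1, erase_insert h2] using this
      _ = _ := (card_union_of_disjoint hdis).symm
      _ ≤ _ := card_le_card hAsub

lemma exists_bij {V γ : Type*} (f g : V → γ) (s : Finset V) :
    ∀ t : Finset V, s.val.map f = t.val.map g →
      ∃ e : V → V, Set.InjOn e s ∧ (∀ x ∈ s, e x ∈ t ∧ g (e x) = f x) ∧
        (∀ y ∈ t, ∃ x ∈ s, e x = y) := by
  classical
  induction s using Finset.induction_on with
  | empty =>
    intro t h
    have ht : t = ∅ := by
      have : t.val = 0 := by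
        rw [← Multiset.map_eq_zero (f := g), ← h]; simp
      exact Finset.val_eq_zero.1 this
    subst ht
    exact ⟨id, by simp, by simp, by simp⟩
  | insert a s ha ih =>
    intro t h
    rw [insert_val_of_notMem ha, Multiset.map_cons] at h
    obtain ⟨b, hb, hba⟩ : ∃ b ∈ t.val, g b = f a := by
      rw [← Multiset.mem_map, ← h]
      exact Multiset.mem_cons_self _ _
    have hb' : b ∈ t := hb
    have h2 : s.val.map f = (t.erase b).val.map g := by
      rw [← insert_erase hb', insert_val_of_notMem (notMem_erase b t), Multiset.map_cons, hba] at h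
      exact (Multiset.cons_inj_right _).1 h
    obtain ⟨e, e1, e2, e3⟩ := ih _ h2
    have hne : ∀ z ∈ s, z ≠ a := fun z hz h => ha (h ▸ hz)
    refine ⟨fun z => if z = a then b else e z, ?_, ?_, ?_⟩
    · intro x hx y hy hxy
      simp only [coe_insert, Set.mem_insert_iff, mem_coe] at hx hy
      have hbs : ∀ z ∈ s, e z ≠ b := fun z hz => (mem_erase.1 (e2 z hz).1).1
      simp only at hxy
      split_ifs at hxy with h1 h2 h2
      · rw [h1, h2]
      · exact absurd hxy.symm (hbs y (hy.resolve_left h2))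
      · exact absurd hxy (hbs x (hx.resolve_left h1))
      · exact e1 (hx.resolve_left h1) (hy.resolve_left h2) hxy
    · intro x hx
      dsimp only
      split_ifs with h1
      · rw [h1]; exact ⟨hb', hba⟩
      · have := e2 x ((mem_insert.1 hx).resolve_left h1)
        exact ⟨(mem_erase.1 this.1).2, this.2⟩
    · intro y hy
      by_cases h1 : y = b
      · exact ⟨a, mem_insert_self _ _, by simp [h1]⟩
      · obtain ⟨x, hx, hxy⟩ := e3 y (mem_erase.2 ⟨h1, hy⟩)
        exact ⟨x, mem_insert_of_mem hx, by simp [hne x hx, hxy]⟩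

end S14

namespace S14

open Finset

set_option linter.unusedSectionVars false

structure RT (V : Type*) where
  r : V
  p : V → V
  d : V → ℕ
  hr : d r = 0
  hp : ∀ v, v ≠ r → d v = d (p v) + 1

namespace RT

variable {V : Type*} [Fintype V] (T : RT V)

def ch (v : V) : Finset V := by
  classical
  exact Finset.univ.filter fun u => u ≠ T.r ∧ T.p u = v

lemma mem_ch {u v : V} : u ∈ T.ch v ↔ u ≠ T.r ∧ T.p u = v := by
  classical
  simp [ch]

lemma wf : WellFounded (fun u v => u ∈ T.ch v) := by
  have : ∀ v, T.d v ≤ Finset.univ.sup T.d := fun v => Finset.le_sup (mem_univ v)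
  refine Subrelation.wf ?_ (measure fun v => Finset.univ.sup T.d - T.d v).wf
  intro u v h
  obtain ⟨h1, h2⟩ := T.mem_ch.1 h
  have h3 := T.hp u h1
  rw [h2] at h3
  have h4 := this u
  show Finset.univ.sup T.d - T.d u < Finset.univ.sup T.d - T.d v
  omega

lemma up {P : V → Prop} (h : ∀ v, (∀ u ∈ T.ch v, P u) → P v) (v : V) : P v :=
  T.wf.induction (C := P) v h

lemma down {P : V → Prop} (h0 : P T.r) (h : ∀ v, v ≠ T.r → P (T.p v) → P v) (v : V) : P v := by
  have : ∀ n v, T.d v = n → P v := by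
    intro n
    induction n with
    | zero =>
      intro v hv
      by_cases hvr : v = T.r
      · rw [hvr]; exact h0
      · have := T.hp v hvr; omega
    | succ n ih =>
      intro v hv
      by_cases hvr : v = T.r
      · rw [hvr]; exact h0
      · have := T.hp v hvr
        exact h v hvr (ih _ (by omega))
  exact this _ v rfl

lemma exists_up {β : Type*} [Inhabited β] (F : V → (V → β) → β)
    (hF : ∀ v g g', (∀ u ∈ T.ch v, g u = g' u) → F v g = F v g') :
    ∃ s : V → β, ∀ v, s v = F v s := by
  classical
  let s : V → β := T.wf.fix (fun v rec => F v fun u => if h : u ∈ T.ch v then rec u h else default)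
  refine ⟨s, fun v => ?_⟩
  have : s v = F v fun u => if h : u ∈ T.ch v then s u else default := T.wf.fix_eq _ v
  rw [this]
  apply hF
  intro u hu
  simp [hu]

lemma exists_down {β : Type*} (a : β) (H : V → β → β) :
    ∃ s : V → β, s T.r = a ∧ ∀ v, v ≠ T.r → s v = H v (s (T.p v)) := by
  let t : ℕ → V → β := fun n => Nat.rec (fun _ => a) (fun _ f v => H v (f (T.p v))) n
  refine ⟨fun v => t (T.d v) v, ?_, ?_⟩
  · simp [T.hr, t]
  · intro v hv
    simp only [T.hp v hv, t]

def enc (i : ℕ) (M : Multiset ℕ) : ℕ := Encodable.encode (i, M)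

lemma enc_inj {i j : ℕ} {M N : Multiset ℕ} (h : enc i M = enc j N) : i = j ∧ M = N := by
  have := Encodable.encode_injective h
  simpa using this

def col (x : ℕ) : ℕ := ((Encodable.decode (α := ℕ × Multiset ℕ) x).getD (0, 0)).1

lemma col_enc (i : ℕ) (M : Multiset ℕ) : col (enc i M) = i := by
  simp [col, enc]

lemma exists_code (φ : V → ℕ) : ∃ s : V → ℕ, ∀ v, s v = enc (φ v) ((T.ch v).val.map s) := by
  apply T.exists_up (fun v s => enc (φ v) ((T.ch v).val.map s))
  intro v g g' h
  congr 1
  exact Multiset.map_congr rfl h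

lemma SDR_congr {A B : V → Finset ℕ} {I : Finset V} (h : ∀ u ∈ I, A u = B u) :
    SDR A I = SDR B I := by
  ext M
  simp only [mem_SDR]
  refine exists_congr fun c => and_congr_right fun _ => and_congr_left fun _ => ?_
  exact forall₂_congr fun u hu => by rw [h u hu]

lemma exists_S (L : V → Finset ℕ) : ∃ S : V → ℕ → Finset ℕ, ∀ v i, S v i =
    if i ∈ L v then (SDR (fun u => ((L u).erase i).biUnion (S u)) (T.ch v)).image
      (fun M => enc i M.val) else ∅ := by
  have := T.exists_up (fun v S i =>
    if i ∈ L v then (SDR (fun u => ((L u).erase i).biUnion (S u)) (T.ch v)).image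
      (fun M => enc i M.val) else ∅) (by
    intro v g g' h
    ext1 i
    have : SDR (fun u => ((L u).erase i).biUnion (g u)) (T.ch v) =
      SDR (fun u => ((L u).erase i).biUnion (g' u)) (T.ch v) := by
      apply SDR_congr
      intro u hu
      rw [h u hu]
    rw [this])
  obtain ⟨S, hS⟩ := this
  exact ⟨S, fun v i => congrFun (hS v) i⟩

def S (L : V → Finset ℕ) : V → ℕ → Finset ℕ := Classical.choose (T.exists_S L)

lemma S_eq (L : V → Finset ℕ) (v : V) (i : ℕ) : T.S L v i =
    if i ∈ L v then (SDR (fun u => ((L u).erase i).biUnion (T.S L u)) (T.ch v)).image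
      (fun M => enc i M.val) else ∅ :=
  Classical.choose_spec (T.exists_S L) v i

lemma mem_S {L : V → Finset ℕ} {v : V} {i x : ℕ} : x ∈ T.S L v i ↔ i ∈ L v ∧
    ∃ c : V → ℕ, Set.InjOn c (T.ch v) ∧
      (∀ u ∈ T.ch v, ∃ j ∈ L u, j ≠ i ∧ c u ∈ T.S L u j) ∧
      x = enc i ((T.ch v).val.map c) := by
  rw [S_eq]
  split_ifs with h
  · simp only [h, true_and, Finset.mem_image, mem_SDR]
    constructor
    · rintro ⟨M, ⟨c, h1, h2, rfl⟩, rfl⟩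
      refine ⟨c, h1, ?_, by rw [image_val_of_injOn h1]⟩
      intro u hu
      obtain ⟨j, hj, hc⟩ := mem_biUnion.1 (h2 u hu)
      exact ⟨j, (mem_erase.1 hj).2, (mem_erase.1 hj).1, hc⟩
    · rintro ⟨c, h1, h2, rfl⟩
      refine ⟨_, ⟨c, h1, ?_, rfl⟩, by rw [image_val_of_injOn h1]⟩
      intro u hu
      obtain ⟨j, hj, hji, hc⟩ := h2 u hu
      exact mem_biUnion.2 ⟨j, mem_erase.2 ⟨hji, hj⟩, hc⟩
  · simp [h]

lemma card_S {L : V → Finset ℕ} {v : V} {i : ℕ} (hi : i ∈ L v) : (T.S L v i).card =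
    (SDR (fun u => ((L u).erase i).biUnion (T.S L u)) (T.ch v)).card := by
  rw [S_eq, if_pos hi, card_image_of_injective]
  intro M N h
  exact Finset.val_injective (enc_inj h).2

lemma S_col {L : V → Finset ℕ} {v : V} {i x : ℕ} (h : x ∈ T.S L v i) : col x = i := by
  obtain ⟨_, c, _, _, rfl⟩ := T.mem_S.1 h
  exact col_enc _ _

lemma S_shape {sh : V → ℕ} (hsh : ∀ v, sh v = enc 0 ((T.ch v).val.map sh))
    {L : V → Finset ℕ} (v : V) : ∀ {w : V} {i j x : ℕ}, x ∈ T.S L v i → x ∈ T.S L w j →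
    sh v = sh w := by
  classical
  induction v using T.up with
  | h v ih =>
    intro w i j x h1 h2
    obtain ⟨_, c, c1, c2, rfl⟩ := T.mem_S.1 h1
    obtain ⟨_, c', c1', c2', he⟩ := T.mem_S.1 h2
    obtain ⟨e, e1, e2, e3⟩ := exists_bij _ _ _ _ (enc_inj he).2
    rw [hsh v, hsh w]
    congr 1
    have hb : ∀ u ∈ T.ch v, sh u = sh (e u) := by
      intro u hu
      obtain ⟨he1, he2⟩ := e2 u hu
      obtain ⟨j, _, _, h3⟩ := c2 u hu
      obtain ⟨j', _, _, h4⟩ := c2' _ he1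
      rw [he2] at h4
      exact ih u hu h3 h4
    have : T.ch w = (T.ch v).image e := by
      ext y
      rw [Finset.mem_image]
      exact ⟨fun h => e3 y h, by rintro ⟨a, ha, rfl⟩; exact (e2 a ha).1⟩
    rw [Multiset.map_congr rfl hb, this, image_val_of_injOn e1, Multiset.map_map]
    rfl

lemma S_const_sub {sh : V → ℕ} (hsh : ∀ v, sh v = enc 0 ((T.ch v).val.map sh))
    (K : Finset ℕ) (v : V) : ∀ {w : V} {i x : ℕ}, sh v = sh w →
      x ∈ T.S (fun _ => K) w i → x ∈ T.S (fun _ => K) v i := by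
  classical
  induction v using T.up with
  | h v ih =>
    intro w i x hvw hx
    rw [hsh v, hsh w] at hvw
    obtain ⟨e, e1, e2, e3⟩ := exists_bij _ _ _ _ (enc_inj hvw).2
    obtain ⟨hi, c, c1, c2, rfl⟩ := T.mem_S.1 hx
    refine T.mem_S.2 ⟨hi, c ∘ e, ?_, ?_, ?_⟩
    · exact c1.comp e1 (fun a ha => (e2 a ha).1)
    · intro u hu
      obtain ⟨j, hj, hji, hc⟩ := c2 _ (e2 u hu).1
      exact ⟨j, hj, hji, ih u hu (e2 u hu).2.symm hc⟩
    · have : T.ch w = (T.ch v).image e := by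
        ext y
        rw [Finset.mem_image]
        exact ⟨fun h => e3 y h, by rintro ⟨a, ha, rfl⟩; exact (e2 a ha).1⟩
      rw [this, image_val_of_injOn e1, Multiset.map_map]

lemma card_le {L : V → Finset ℕ} {K : Finset ℕ} (hL : ∀ v, (L v).card = K.card) (v : V) :
    ∀ {i j : ℕ}, i ∈ L v → j ∈ K → (T.S (fun _ => K) v j).card ≤ (T.S L v i).card := by
  obtain ⟨sh, hsh⟩ := T.exists_code (fun _ => 0)
  classical
  induction v using T.up with
  | h v ih =>
    intro i j hi hj
    rw [T.card_S hi, T.card_S hj]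
    apply sdr_le sh _ _ _ _ le_rfl
    · intro u hu
      have hd : ∀ (L : V → Finset ℕ) i, (((L u).erase i).biUnion (T.S L u)).card =
          ∑ a ∈ (L u).erase i, (T.S L u a).card := by
        intro L i
        apply card_biUnion
        intro a _ b _ hab
        show Disjoint (T.S L u a) (T.S L u b)
        rw [Finset.disjoint_left]
        intro x h1 h2
        exact hab ((T.S_col h1).symm.trans (T.S_col h2))
      rw [hd L i, hd (fun _ => K) j]
      have hcard : (K.erase j).card ≤ ((L u).erase i).card := by
        rw [card_erase_of_mem hj, ← hL u]
        exact pred_card_le_card_erase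
      obtain ⟨D, hD, hDc⟩ := exists_subset_card_eq hcard
      let e := Finset.equivOfCardEq hDc
      calc ∑ a ∈ K.erase j, (T.S (fun _ => K) u a).card
          = ∑ a : D, (T.S (fun _ => K) u (e a)).card := by
            rw [← Finset.sum_coe_sort (K.erase j)]
            exact (Equiv.sum_comp e (fun a : (K.erase j : Finset ℕ) => (T.S (fun _ => K) u a).card)).symm
        _ ≤ ∑ a : D, (T.S L u a).card := by
            apply Finset.sum_le_sum
            intro a _
            exact ih u hu (mem_erase.1 (hD a.2)).2 (mem_erase.1 (e a).2).2
        _ = ∑ a ∈ D, (T.S L u a).card := Finset.sum_coe_sort D (fun a => (T.S L u a).card)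
        _ ≤ _ := Finset.sum_le_sum_of_subset hD
    · intro u _ w _ h
      have : T.S (fun _ => K) u = T.S (fun _ => K) w := by
        ext a x
        exact ⟨T.S_const_sub hsh K w h.symm, T.S_const_sub hsh K u h⟩
      simp only [this]
    · intro u _ w _ h
      rw [Finset.disjoint_left]
      intro x h1 h2
      obtain ⟨a, _, h1⟩ := mem_biUnion.1 h1
      obtain ⟨b, _, h2⟩ := mem_biUnion.1 h2
      exact h (T.S_shape hsh u h1 h2)
    · intro u _ w _ h
      rw [Finset.disjoint_left]
      intro x h1 h2
      obtain ⟨a, _, h1⟩ := mem_biUnion.1 h1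
      obtain ⟨b, _, h2⟩ := mem_biUnion.1 h2
      exact h (T.S_shape hsh u h1 h2)

end RT
end S14

namespace S14

open Finset

namespace RT

variable {V : Type*} [Fintype V] (T : RT V)

/-- `G` is the tree graph described by `T`. -/
def Rep (G : SimpleGraph V) : Prop :=
  ∀ a b, G.Adj a b ↔ (b ≠ T.r ∧ T.p b = a) ∨ (a ≠ T.r ∧ T.p a = b)

lemma code_mem {G : SimpleGraph V} (hG : T.Rep G) {K : Finset ℕ} {φ s : V → ℕ}
    (hφ : ∀ v, φ v ∈ K) (hprop : IsProper G φ)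
    (hs : ∀ v, s v = enc (φ v) ((T.ch v).val.map s))
    (hinj : ∀ v, Set.InjOn s (T.ch v)) (v : V) : s v ∈ T.S (fun _ => K) v (φ v) := by
  induction v using T.up with
  | h v ih =>
    refine T.mem_S.2 ⟨hφ v, s, hinj v, ?_, hs v⟩
    intro u hu
    exact ⟨φ u, hφ u, hprop u v ((hG _ _).2 (Or.inr (T.mem_ch.1 hu))), ih u hu⟩

lemma code_inj {G : SimpleGraph V} (hG : T.Rep G) {φ s : V → ℕ}
    (hd : Distinguishes G T.r φ)
    (hs : ∀ v, s v = enc (φ v) ((T.ch v).val.map s)) (v₀ : V) : Set.InjOn s (T.ch v₀) := by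
  classical
  intro u hu u' hu' huu
  by_contra hne
  have hch : ∀ v v', ∃ e : V → V, s v = s v' → Set.InjOn e (T.ch v) ∧
      (∀ x ∈ T.ch v, e x ∈ T.ch v' ∧ s (e x) = s x) ∧ (v = v₀ → v' = v₀ → e u = u') := by
    intro v v'
    by_cases h : v = v₀ ∧ v' = v₀
    · obtain ⟨rfl, rfl⟩ := h
      refine ⟨Equiv.swap u u', fun _ => ⟨(Equiv.injective _).injOn, ?_, fun _ _ => by simp⟩⟩
      intro x hx
      rcases eq_or_ne x u with rfl | h1
      · simp only [Equiv.swap_apply_left]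
        exact ⟨hu', huu.symm⟩
      · rcases eq_or_ne x u' with rfl | h2
        · simp only [Equiv.swap_apply_right]
          exact ⟨hu, huu⟩
        · rw [Equiv.swap_apply_of_ne_of_ne h1 h2]
          exact ⟨hx, rfl⟩
    · by_cases hvv : s v = s v'
      · have h2 := hvv
        rw [hs v, hs v'] at h2
        obtain ⟨e, e1, e2, _⟩ := exists_bij _ _ _ _ (enc_inj h2).2
        exact ⟨e, fun _ => ⟨e1, e2, fun h3 h4 => absurd ⟨h3, h4⟩ h⟩⟩
      · exact ⟨id, fun h => absurd h hvv⟩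
  choose e he using hch
  obtain ⟨σ, σr, σs⟩ := T.exists_down T.r (fun v y => e (T.p v) y v)
  have hc : ∀ v, s (σ v) = s v := by
    intro v
    induction v using T.down with
    | h0 => rw [σr]
    | h v hv ih =>
      rw [σs v hv]
      exact ((he _ _ ih.symm).2.1 v (T.mem_ch.2 ⟨hv, rfl⟩)).2
  have hpar : ∀ v, v ≠ T.r → σ v ≠ T.r ∧ T.p (σ v) = σ (T.p v) := by
    intro v hv
    have := ((he _ _ (hc (T.p v)).symm).2.1 v (T.mem_ch.2 ⟨hv, rfl⟩)).1
    rw [← σs v hv] at this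
    exact T.mem_ch.1 this
  have hinj : Function.Injective σ := by
    intro v
    induction v using T.down with
    | h0 =>
      intro w h
      by_contra hw
      exact (hpar w (Ne.symm hw)).1 (h.symm.trans σr)
    | h v hv ih =>
      intro w h
      have hw : w ≠ T.r := by
        rintro rfl
        exact (hpar v hv).1 (h.trans σr)
      have hp : T.p v = T.p w := by
        apply ih
        rw [← (hpar v hv).2, ← (hpar w hw).2, h]
      rw [σs v hv, σs w hw, ← hp] at h
      exact (he _ _ (hc (T.p v)).symm).1 (T.mem_ch.2 ⟨hv, rfl⟩) (T.mem_ch.2 ⟨hw, hp.symm⟩) h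
  have hbij : Function.Bijective σ := Finite.injective_iff_bijective.1 hinj
  have hr : ∀ v, σ v ≠ T.r ↔ v ≠ T.r := fun v =>
    ⟨fun h h2 => h (by rw [h2, σr]), fun h => (hpar v h).1⟩
  have hpp : ∀ a b, (σ b ≠ T.r ∧ T.p (σ b) = σ a) ↔ (b ≠ T.r ∧ T.p b = a) := by
    intro a b
    rw [hr]
    refine and_congr_right fun hb => ?_
    rw [(hpar b hb).2]
    exact hinj.eq_iff
  let τ : G ≃g G := ⟨Equiv.ofBijective σ hbij, by
    intro a b
    show G.Adj (σ a) (σ b) ↔ G.Adj a b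
    rw [hG, hG, hpp, hpp]⟩
  have hτ := hd τ σr (fun w => by
    have := hc w
    rw [hs, hs w] at this
    exact (enc_inj this).1)
  have h1 : σ v₀ = v₀ := hτ v₀
  have h2 : σ u = u := hτ u
  obtain ⟨hur, hup⟩ := T.mem_ch.1 hu
  rw [σs u hur, hup, h1] at h2
  rw [(he _ _ rfl).2.2 rfl rfl] at h2
  exact hne h2.symm

lemma aut_parent {G : SimpleGraph V} (hG : T.Rep G) (σ : G ≃g G) (hσ : σ T.r = T.r) (v : V) :
    v ≠ T.r → T.p (σ v) = σ (T.p v) := by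
  induction v using T.down with
  | h0 => intro h; exact absurd rfl h
  | h v hv ih =>
    intro _
    have hadj : G.Adj (σ v) (σ (T.p v)) := σ.map_adj_iff.2 ((hG _ _).2 (Or.inr ⟨hv, rfl⟩))
    rcases (hG _ _).1 hadj with ⟨h1, h2⟩ | ⟨_, h2⟩
    · exfalso
      have hpv : T.p v ≠ T.r := fun h => h1 (by rw [h, hσ])
      rw [ih hpv] at h2
      have h3 : T.p (T.p v) = v := σ.injective h2
      have h4 := T.hp v hv
      have h5 := T.hp _ hpv
      rw [h3] at h5
      omega
    · exact h2

lemma dist_of_code {G : SimpleGraph V} (hG : T.Rep G) {ψ s : V → ℕ}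
    (hs : ∀ v, s v = enc (ψ v) ((T.ch v).val.map s))
    (hinj : ∀ v, Set.InjOn s (T.ch v)) : Distinguishes G T.r ψ := by
  classical
  intro σ hσ hcol
  have hpar := T.aut_parent hG σ hσ
  have hne : ∀ v, σ v ≠ T.r ↔ v ≠ T.r := fun v => by
    rw [not_iff_not, ← hσ, σ.injective.eq_iff, hσ]
  have hch : ∀ v, T.ch (σ v) = (T.ch v).image σ := by
    intro v
    ext y
    rw [Finset.mem_image]
    constructor
    · intro h
      obtain ⟨u, rfl⟩ := σ.surjective y
      obtain ⟨h1, h2⟩ := T.mem_ch.1 h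
      have hu := (hne u).1 h1
      rw [hpar u hu] at h2
      exact ⟨u, T.mem_ch.2 ⟨hu, σ.injective h2⟩, rfl⟩
    · rintro ⟨u, hu, rfl⟩
      obtain ⟨h1, h2⟩ := T.mem_ch.1 hu
      exact T.mem_ch.2 ⟨(hne u).2 h1, by rw [hpar u h1, h2]⟩
  have hsσ : ∀ v, s (σ v) = s v := by
    intro v
    induction v using T.up with
    | h v ih =>
      rw [hs, hs v, hcol, hch, image_val_of_injOn σ.injective.injOn, Multiset.map_map]
      congr 1
      exact Multiset.map_congr rfl ih
  intro w
  induction w using T.down with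
  | h0 => exact hσ
  | h v hv ih =>
    exact hinj (T.p v) (T.mem_ch.2 ⟨(hne v).2 hv, by rw [hpar v hv, ih]⟩)
      (T.mem_ch.2 ⟨hv, rfl⟩) (hsσ v)

lemma realize {G : SimpleGraph V} (hG : T.Rep G) {L : V → Finset ℕ} {x i : ℕ}
    (hx : x ∈ T.S L T.r i) :
    ∃ ψ : V → ℕ, (∀ v, ψ v ∈ L v) ∧ IsProper G ψ ∧ Distinguishes G T.r ψ := by
  have hch : ∀ v x, ∃ c : V → ℕ, x ∈ T.S L v (col x) → Set.InjOn c (T.ch v) ∧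
      (∀ u ∈ T.ch v, ∃ j ∈ L u, j ≠ col x ∧ c u ∈ T.S L u j) ∧
      x = enc (col x) ((T.ch v).val.map c) := by
    intro v x
    by_cases h : x ∈ T.S L v (col x)
    · obtain ⟨_, c, hc⟩ := T.mem_S.1 h
      exact ⟨c, fun _ => hc⟩
    · exact ⟨fun _ => 0, fun h' => absurd h' h⟩
  choose c hc using hch
  obtain ⟨s, s0, s1⟩ := T.exists_down x (fun v y => c (T.p v) y v)
  have hmem : ∀ v, s v ∈ T.S L v (col (s v)) := by
    intro v
    induction v using T.down with
    | h0 => rw [s0, T.S_col hx]; exact hx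
    | h v hv ih =>
      obtain ⟨j, _, _, hj⟩ := (hc _ _ ih).2.1 v (T.mem_ch.2 ⟨hv, rfl⟩)
      rw [← s1 v hv] at hj
      rw [T.S_col hj]; exact hj
  have hsc : ∀ v, ∀ u ∈ T.ch v, s u = c v (s v) u := by
    intro v u hu
    obtain ⟨h1, h2⟩ := T.mem_ch.1 hu
    rw [s1 u h1, h2]
  have hne : ∀ u, u ≠ T.r → col (s u) ≠ col (s (T.p u)) := by
    intro u hu
    obtain ⟨j, _, hne, hj⟩ := (hc _ _ (hmem (T.p u))).2.1 u (T.mem_ch.2 ⟨hu, rfl⟩)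
    rw [← s1 u hu] at hj
    rw [T.S_col hj]; exact hne
  refine ⟨fun v => col (s v), fun v => (T.mem_S.1 (hmem v)).1, ?_, ?_⟩
  · intro a b hab
    rcases (hG _ _).1 hab with ⟨h1, rfl⟩ | ⟨h1, rfl⟩
    · exact (hne b h1).symm
    · exact hne a h1
  · apply T.dist_of_code hG (s := s)
    · intro v
      conv_lhs => rw [(hc _ _ (hmem v)).2.2]
      congr 1
      exact Multiset.map_congr rfl fun u hu => (hsc v u hu).symm
    · intro v a ha b hb hab
      rw [hsc v a ha, hsc v b hb] at hab
      exact (hc _ _ (hmem v)).1 ha hb hab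

theorem rooted {G : SimpleGraph V} (hG : T.Rep G) {k : ℕ} {φ : V → Fin k}
    (hprop : IsProper G φ) (hd : Distinguishes G T.r φ) {L : V → Finset ℕ}
    (hL : ∀ v, (L v).card = k) :
    ∃ ψ : V → ℕ, (∀ v, ψ v ∈ L v) ∧ IsProper G ψ ∧ Distinguishes G T.r ψ := by
  let φ' : V → ℕ := fun v => φ v
  have hφ' : ∀ v, φ' v ∈ Finset.range k := fun v => Finset.mem_range.2 (φ v).2
  obtain ⟨s, hs⟩ := T.exists_code φ'
  have hinj := T.code_inj hG (φ := φ') (s := s) (fun σ h1 h2 => hd σ h1 fun w => Fin.ext (h2 w)) hs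
  have hmem := T.code_mem hG hφ' (fun a b h h2 => hprop a b h (Fin.ext h2)) hs hinj T.r
  obtain ⟨i, hi⟩ : (L T.r).Nonempty := by
    rw [← card_pos, hL]
    exact (φ T.r).pos
  have hle := T.card_le (L := L) (K := Finset.range k) (by simpa using hL) T.r hi (hφ' T.r)
  obtain ⟨x, hx⟩ := card_pos.1 (lt_of_lt_of_le (card_pos.2 ⟨_, hmem⟩) hle)
  exact T.realize hG hx

end RT

section graph

variable {V : Type*} [Fintype V] {G : SimpleGraph V}

lemma closer_unique (hG : G.IsTree) {u v a b : V} (ha : G.Adj v a) (hb : G.Adj v b)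
    (hda : G.dist v u = G.dist a u + 1) (hdb : G.dist v u = G.dist b u + 1) : a = b := by
  obtain ⟨p, hp⟩ := hG.connected.exists_walk_length_eq_dist a u
  obtain ⟨q, hq⟩ := hG.connected.exists_walk_length_eq_dist b u
  have h1 : (Walk.cons ha p).IsPath := Walk.isPath_of_length_eq_dist _ (by simp [hp, hda])
  have h2 : (Walk.cons hb q).IsPath := Walk.isPath_of_length_eq_dist _ (by simp [hq, hdb])
  have := (hG.existsUnique_path v u).unique h1 h2
  have h3 := congrArg Walk.snd this
  simpa using h3

lemma closer_exists (hG : G.IsTree) {u v : V} (h : v ≠ u) :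
    ∃ a, G.Adj v a ∧ G.dist v u = G.dist a u + 1 := by
  obtain ⟨p, hp⟩ := hG.connected.exists_walk_length_eq_dist v u
  cases p with
  | nil => exact absurd rfl h
  | @cons _ a _ ha q =>
    refine ⟨a, ha, ?_⟩
    have h1 := dist_le q
    rw [Walk.length_cons] at hp
    rcases hG.dist_eq_dist_add_one_of_adj u ha with h2 | h2 <;>
      rw [dist_comm (v := v), dist_comm (v := a)] at h2 <;> omega

lemma exists_RT (hG : G.IsTree) (r : V) :
    ∃ T : RT V, T.r = r ∧ T.Rep G ∧ ∀ v, T.d v = G.dist v r := by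
  classical
  have : ∀ v, ∃ a, v ≠ r → G.Adj v a ∧ G.dist v r = G.dist a r + 1 := by
    intro v
    by_cases h : v = r
    · exact ⟨v, fun h' => absurd h h'⟩
    · obtain ⟨a, ha⟩ := closer_exists hG h
      exact ⟨a, fun _ => ha⟩
  choose p hp using this
  refine ⟨⟨r, p, fun v => G.dist v r, by simp, fun v hv => (hp v hv).2⟩, rfl, ?_, fun _ => rfl⟩
  have aux : ∀ a b, G.Adj a b → G.dist a r = G.dist b r + 1 → a ≠ r ∧ p a = b := by
    intro a b hab h
    have har : a ≠ r := by
      rintro rfl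
      simp at h
    exact ⟨har, closer_unique hG (hp a har).1 hab (hp a har).2 h⟩
  intro a b
  show G.Adj a b ↔ (b ≠ r ∧ p b = a) ∨ (a ≠ r ∧ p a = b)
  constructor
  · intro hab
    rcases hG.dist_eq_dist_add_one_of_adj r hab with h2 | h2 <;>
      rw [dist_comm (v := a), dist_comm (v := b)] at h2
    · exact Or.inr (aux a b hab h2)
    · exact Or.inl (aux b a hab.symm h2)
  · rintro (⟨h1, rfl⟩ | ⟨h1, rfl⟩)
    · exact (hp b h1).1.symm
    · exact (hp a h1).1

lemma convex (hG : G.IsTree) {x y z : V} (hx : G.Adj y x) (hz : G.Adj y z) (hxz : x ≠ z) :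
    2 * ∑ u, G.dist y u < ∑ u, G.dist x u + ∑ u, G.dist z u := by
  rw [Finset.mul_sum, ← Finset.sum_add_distrib]
  apply Finset.sum_lt_sum
  · intro u _
    by_contra h
    have h1 := hG.dist_eq_dist_add_one_of_adj u hx
    have h2 := hG.dist_eq_dist_add_one_of_adj u hz
    rw [dist_comm (u := u) (v := y), dist_comm (u := u) (v := x)] at h1
    rw [dist_comm (u := u) (v := y), dist_comm (u := u) (v := z)] at h2
    exact hxz (closer_unique hG hx hz (u := u) (by omega) (by omega))
  · refine ⟨y, Finset.mem_univ _, ?_⟩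
    have h1 := dist_eq_one_iff_adj.2 hx.symm
    have h2 := dist_eq_one_iff_adj.2 hz.symm
    simp [h1, h2]

lemma iso_dist_le (hG : G.IsTree) (σ : G ≃g G) (a b : V) :
    G.dist (σ a) (σ b) ≤ G.dist a b := by
  obtain ⟨p, hp⟩ := hG.connected.exists_walk_length_eq_dist a b
  have := dist_le (p.map σ.toHom)
  rw [Walk.length_map, hp] at this
  exact this

lemma iso_dist (hG : G.IsTree) (σ : G ≃g G) (a b : V) : G.dist (σ a) (σ b) = G.dist a b := by
  apply le_antisymm (iso_dist_le hG σ a b)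
  have := iso_dist_le hG σ.symm (σ a) (σ b)
  simpa using this

lemma exists_center (hG : G.IsTree) :
    ∃ r, ∀ σ : G ≃g G, σ r = r ∨ G.Adj r (σ r) := by
  have := hG.connected.nonempty
  obtain ⟨r, hr⟩ := Finite.exists_min (fun v => ∑ u, G.dist v u)
  refine ⟨r, fun σ => ?_⟩
  obtain ⟨T, rfl, hT, hd⟩ := exists_RT hG r
  have key : ∀ v, v ≠ T.r → ∑ u, G.dist (T.p v) u ≤ ∑ u, G.dist v u ∧
      (T.p v ≠ T.r → ∑ u, G.dist (T.p v) u < ∑ u, G.dist v u) := by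
    intro v
    induction v using T.down with
    | h0 => intro h; exact absurd rfl h
    | h v hv ih =>
      intro _
      by_cases hpv : T.p v = T.r
      · rw [hpv]
        exact ⟨hr v, fun h => absurd rfl h⟩
      · have h1 := (ih hpv).1
        have h2 := convex hG (x := T.p (T.p v)) (y := T.p v) (z := v)
          ((hT _ _).2 (Or.inr ⟨hpv, rfl⟩)) ((hT _ _).2 (Or.inl ⟨hv, rfl⟩)) (by
            intro h3
            have h4 := T.hp v hv
            have h5 := T.hp _ hpv
            rw [h3] at h5
            omega)
        exact ⟨by omega, fun _ => by omega⟩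
  have hσ : ∑ u, G.dist (σ T.r) u = ∑ u, G.dist T.r u := by
    rw [← Equiv.sum_comp σ.toEquiv]
    exact Finset.sum_congr rfl fun u _ => iso_dist hG σ T.r u
  by_cases h : σ T.r = T.r
  · exact Or.inl h
  · right
    have h2 : T.p (σ T.r) = T.r := by
      by_contra h3
      have h4 := (key _ h).2 h3
      have h5 := hr (T.p (σ T.r))
      omega
    exact (hT _ _).2 (Or.inl ⟨h, h2⟩)

end graph

end S14

theorem stmt14 {V : Type*} [Fintype V] (G : SimpleGraph V) (hG : G.IsTree) :
    chiDU G = chiDLU G := by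
  obtain ⟨r, hr⟩ := S14.exists_center hG
  obtain ⟨T, rfl, hT, -⟩ := S14.exists_RT hG r
  unfold chiDU chiDLU
  congr 1
  ext k
  constructor
  · rintro ⟨φ, hφ, hd⟩ L hL
    obtain ⟨ψ, h1, h2, h3⟩ := T.rooted hT hφ (fun σ _ h => hd σ h) hL
    refine ⟨ψ, h1, h2, fun σ hσ => h3 σ ?_ hσ⟩
    rcases hr σ with h | h
    · exact h
    · exact absurd (hσ T.r).symm (h2 _ _ h)
  · intro h
    obtain ⟨φ, h1, h2, h3⟩ := h (fun _ => Finset.range k) (by simp)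
    refine ⟨fun v => ⟨φ v, Finset.mem_range.1 (h1 v)⟩, ?_, ?_⟩
    · intro a b hab h
      exact h2 a b hab (congrArg Fin.val h)
    · intro σ hσ
      exact h3 σ fun w => congrArg Fin.val (hσ w)
end
end
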